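/- Let φ be an N-function with the good φ' property with constant G and let d ≥ 1. Then there exists a constant C depending only on G and d such that for every ball B_r ⊂ ℝ^d of radius r > 0 and every continuously differentiable map u : ℝ^d → ℝ^d one has the Orlicz–Korn inequality: ∫_{B_r} φ(|∇u|) ≤ C·∫_{B_r} ( φ(|Du|) + φ(|u − ⟨u⟩_{B_r}|/r) ), where ∇u is the Jacobian matrix, Du = (∇u + (∇u)ᵀ)/2 is its symmetric part, ⟨u⟩_{B_r} is the average of u over B_r, and |·| denotes the Frobenius norm on matrices and the Euclidean norm on vectors (Lemma 7). -/

import Mathlib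

open MeasureTheory Real Set Filter

noncomputable section

/-- `φ` is an N-function with right-continuous, non-decreasing density `φ'`:
`φ t = ∫₀ᵗ φ'`, `φ'(0) = 0`, `φ' > 0` on `(0,∞)`, `φ'(t) → ∞` as `t → ∞`. -/
def IsNFunction (φ φ' : ℝ → ℝ) : Prop :=
  (∀ t, 0 ≤ t → φ t = ∫ s in (0:ℝ)..t, φ' s) ∧
  (∀ s, 0 ≤ s → 0 ≤ φ' s) ∧
  (∀ s t, 0 ≤ s → s ≤ t → φ' s ≤ φ' t) ∧
  φ' 0 = 0 ∧
  (∀ t, 0 < t → 0 < φ' t) ∧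
  Filter.Tendsto φ' Filter.atTop Filter.atTop ∧
  (∀ t, 0 ≤ t → ContinuousWithinAt φ' (Set.Ici t) t)

/-- The Δ₂ condition with constant `K`: `φ(2t) ≤ K·φ(t)` for all `t ≥ 0`. -/
def Delta2 (φ : ℝ → ℝ) (K : ℝ) : Prop := ∀ t, 0 ≤ t → φ (2 * t) ≤ K * φ t

/-- The complementary (conjugate) function `φ*(t) = sup_{s ≥ 0} (t·s − φ(s))`. -/
def conjFn (φ : ℝ → ℝ) (t : ℝ) : ℝ := sSup {x | ∃ s, 0 ≤ s ∧ x = t * s - φ s}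

/-- The good `φ'` property with constant `G ≥ 1`:
`φ` is `C¹` on `[0,∞)` and `C²` on `(0,∞)` with
`G⁻¹·φ'(t) ≤ t·φ''(t) ≤ G·φ'(t)` for `t > 0`. -/
def GoodPhi (φ φ' φ'' : ℝ → ℝ) (G : ℝ) : Prop :=
  1 ≤ G ∧
  (∀ t, 0 < t → HasDerivAt φ (φ' t) t) ∧
  (∀ t, 0 < t → HasDerivAt φ' (φ'' t) t) ∧
  ContinuousWithinAt φ' (Set.Ici 0) 0 ∧
  (∀ t, 0 < t → ContinuousAt φ'' t) ∧
  (∀ t, 0 < t → G⁻¹ * φ' t ≤ t * φ'' t ∧ t * φ'' t ≤ G * φ' t)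

/-- Frobenius inner product `P : Q = ∑ᵢⱼ Pᵢⱼ·Qᵢⱼ`. -/
def minner {d : ℕ} (P Q : Matrix (Fin d) (Fin d) ℝ) : ℝ := ∑ i, ∑ j, P i j * Q i j

/-- Frobenius norm `|P| = √(P : P)`. -/
def fnorm {d : ℕ} (P : Matrix (Fin d) (Fin d) ℝ) : ℝ := Real.sqrt (minner P P)

/-- The tensor `Q ↦ g(|Q|)·Q/|Q|` (with value `0` at `Q = 0`). -/
def tensorT {d : ℕ} (g : ℝ → ℝ) (Q : Matrix (Fin d) (Fin d) ℝ) :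
    Matrix (Fin d) (Fin d) ℝ :=
  if Q = 0 then 0 else (g (fnorm Q) / fnorm Q) • Q

/-- The Jacobian matrix of a vector field `u : ℝ^d → ℝ^d` at a point `x`. -/
def jac {d : ℕ} (u : EuclideanSpace ℝ (Fin d) → EuclideanSpace ℝ (Fin d))
    (x : EuclideanSpace ℝ (Fin d)) : Matrix (Fin d) (Fin d) ℝ :=
  Matrix.of fun i j => fderiv ℝ u x (EuclideanSpace.single j 1) i

noncomputable section

/-! ### Elementary facts on N-functions with the good property -/

section phi
variable {φ φ' φ'' : ℝ → ℝ} {G : ℝ}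

lemma phi_zero (hN : IsNFunction φ φ') : φ 0 = 0 := by
  rw [hN.1 0 le_rfl]; simp

lemma phi'_cont (hG : GoodPhi φ φ' φ'' G) : ContinuousOn φ' (Ici 0) := by
  intro t ht
  rcases eq_or_lt_of_le (mem_Ici.1 ht) with h | h
  · rw [← h]; exact hG.2.2.2.1
  · exact (hG.2.2.1 t h).continuousAt.continuousWithinAt

lemma phi_cont (hN : IsNFunction φ φ') (hG : GoodPhi φ φ' φ'' G) : ContinuousOn φ (Ici 0) := by
  have hc : Continuous (fun s => φ' (max s 0)) := by
    refine (phi'_cont hG).comp_continuous (by fun_prop) (fun x => mem_Ici.2 (le_max_right _ _))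
  have h2 : Continuous (fun t => ∫ s in (0:ℝ)..t, φ' (max s 0)) :=
    intervalIntegral.continuous_primitive (fun a b => hc.intervalIntegrable a b) 0
  refine h2.continuousOn.congr ?_
  intro t ht
  rw [hN.1 t ht]
  refine intervalIntegral.integral_congr ?_
  intro s hs
  rw [uIcc_of_le (mem_Ici.1 ht)] at hs
  simp [max_eq_left hs.1]

lemma phi_mono (hN : IsNFunction φ φ') (hG : GoodPhi φ φ' φ'' G) : MonotoneOn φ (Ici 0) := by
  refine monotoneOn_of_deriv_nonneg (convex_Ici 0) (phi_cont hN hG) ?_ ?_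
  · intro x hx
    rw [interior_Ici] at hx
    exact (hG.2.1 x hx).differentiableAt.differentiableWithinAt
  · intro x hx
    rw [interior_Ici] at hx
    rw [(hG.2.1 x hx).deriv]
    exact hN.2.1 x hx.le

lemma phi_nonneg (hN : IsNFunction φ φ') (hG : GoodPhi φ φ' φ'' G) {t : ℝ} (ht : 0 ≤ t) :
    0 ≤ φ t := by
  rw [← phi_zero hN]
  exact phi_mono hN hG (mem_Ici.2 le_rfl) ht ht

lemma phi_lower (hN : IsNFunction φ φ') (hG : GoodPhi φ φ' φ'' G) {t : ℝ} (ht : 0 ≤ t) :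
    (1 + G⁻¹) * φ t ≤ t * φ' t := by
  have hm : MonotoneOn (fun t => t * φ' t - (1 + G⁻¹) * φ t) (Ici 0) := by
    refine monotoneOn_of_deriv_nonneg (convex_Ici 0) ?_ ?_ ?_
    · exact (continuousOn_id.mul (phi'_cont hG)).sub (continuousOn_const.mul (phi_cont hN hG))
    · intro x hx
      rw [interior_Ici] at hx
      exact (((hasDerivAt_id x).mul (hG.2.2.1 x hx)).sub
        ((hG.2.1 x hx).const_mul (1 + G⁻¹))).differentiableAt.differentiableWithinAt
    · intro x hx
      rw [interior_Ici] at hx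
      have := ((hasDerivAt_id x).mul (hG.2.2.1 x hx)).sub ((hG.2.1 x hx).const_mul (1 + G⁻¹))
      erw [this.deriv]
      have h2 := (hG.2.2.2.2.2 x hx).1
      simp only [id]
      linarith
  have := hm (mem_Ici.2 le_rfl) ht ht
  simp only [phi_zero hN] at this
  linarith

lemma phi_upper (hN : IsNFunction φ φ') (hG : GoodPhi φ φ' φ'' G) {t : ℝ} (ht : 0 ≤ t) :
    t * φ' t ≤ (1 + G) * φ t := by
  have hm : MonotoneOn (fun t => (1 + G) * φ t - t * φ' t) (Ici 0) := by
    refine monotoneOn_of_deriv_nonneg (convex_Ici 0) ?_ ?_ ?_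
    · exact (continuousOn_const.mul (phi_cont hN hG)).sub (continuousOn_id.mul (phi'_cont hG))
    · intro x hx
      rw [interior_Ici] at hx
      exact (((hG.2.1 x hx).const_mul (1 + G)).sub
        ((hasDerivAt_id x).mul (hG.2.2.1 x hx))).differentiableAt.differentiableWithinAt
    · intro x hx
      rw [interior_Ici] at hx
      have := ((hG.2.1 x hx).const_mul (1 + G)).sub ((hasDerivAt_id x).mul (hG.2.2.1 x hx))
      erw [this.deriv]
      have h2 := (hG.2.2.2.2.2 x hx).2
      simp only [id]
      linarith
  have := hm (mem_Ici.2 le_rfl) ht ht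
  simp only [phi_zero hN] at this
  linarith

lemma phi_pos (hN : IsNFunction φ φ') (hG : GoodPhi φ φ' φ'' G) {t : ℝ} (ht : 0 < t) :
    0 < φ t := by
  have h1 := phi_upper hN hG ht.le
  have h2 : 0 < t * φ' t := mul_pos ht (hN.2.2.2.2.1 t ht)
  have h3 := hG.1
  by_contra h
  push Not at h
  nlinarith

lemma phi_scale (hN : IsNFunction φ φ') (hG : GoodPhi φ φ' φ'' G) {l t : ℝ} (hl : 1 ≤ l)
    (ht : 0 ≤ t) : φ (l * t) ≤ l ^ (1 + G) * φ t := by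
  rcases eq_or_lt_of_le ht with h | h
  · rw [← h]; simp [phi_zero hN]
  have hm : AntitoneOn (fun t => φ t * t ^ (-(1 + G))) (Ioi 0) := by
    have hd : ∀ x, 0 < x → HasDerivAt (fun t => φ t * t ^ (-(1 + G)))
        (φ' x * x ^ (-(1 + G)) + φ x * (-(1 + G) * x ^ (-(1 + G) - 1))) x := fun x hx =>
      (hG.2.1 x hx).mul (Real.hasDerivAt_rpow_const (Or.inl hx.ne'))
    refine antitoneOn_of_deriv_nonpos (convex_Ioi 0) ?_ ?_ ?_
    · exact fun x hx => (hd x hx).continuousAt.continuousWithinAt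
    · intro x hx
      rw [interior_Ioi] at hx
      exact (hd x hx).differentiableAt.differentiableWithinAt
    · intro x hx
      rw [interior_Ioi] at hx
      rw [(hd x hx).deriv]
      have hx' : 0 < x := hx
      rw [Real.rpow_sub_one hx'.ne']
      have h1 := phi_upper hN hG hx'.le
      have h3 : 0 < x ^ (-(1 + G)) := Real.rpow_pos_of_pos hx' _
      have : φ' x * x ^ (-(1 + G)) + φ x * (-(1 + G) * (x ^ (-(1 + G)) / x))
        = (x * φ' x - (1 + G) * φ x) * (x ^ (-(1 + G)) / x) := by field_simp; ring
      rw [this]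
      exact mul_nonpos_of_nonpos_of_nonneg (by linarith) (by positivity)
  have hlt : t ≤ l * t := by nlinarith
  have := hm (mem_Ioi.2 h) (mem_Ioi.2 (by positivity : 0 < l * t)) hlt
  simp only at this
  rw [Real.mul_rpow (by linarith) ht, Real.rpow_neg (by linarith), Real.rpow_neg ht] at this
  have h1 : 0 < l ^ (1 + G) := Real.rpow_pos_of_pos (by linarith) _
  have h2 : 0 < t ^ (1 + G) := Real.rpow_pos_of_pos h _
  field_simp at this
  exact this

/-- the auxiliary function `φ(s)/s` and its derivatives -/
def gz (φ : ℝ → ℝ) (s : ℝ) : ℝ := φ s / s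
def gz1 (φ φ' : ℝ → ℝ) (s : ℝ) : ℝ := φ' s / s - φ s / s ^ 2
def gz2 (φ φ' φ'' : ℝ → ℝ) (s : ℝ) : ℝ := φ'' s / s - 2 * φ' s / s ^ 2 + 2 * φ s / s ^ 3

lemma gz_hasDeriv (hG : GoodPhi φ φ' φ'' G) {s : ℝ} (hs : 0 < s) :
    HasDerivAt (gz φ) (gz1 φ φ' s) s := by
  have := (hG.2.1 s hs).div (hasDerivAt_id s) hs.ne'
  refine this.congr_deriv ?_
  simp only [gz1, id]; field_simp

lemma gz1_hasDeriv (hG : GoodPhi φ φ' φ'' G) {s : ℝ} (hs : 0 < s) :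
    HasDerivAt (gz1 φ φ') (gz2 φ φ' φ'' s) s := by
  have h1 := (hG.2.2.1 s hs).div (hasDerivAt_id s) hs.ne'
  have h2 := (hG.2.1 s hs).div (hasDerivAt_pow 2 s) (pow_ne_zero 2 hs.ne')
  refine (h1.sub h2).congr_deriv ?_
  simp only [gz2, id]; field_simp; push_cast; ring

lemma gz2_cont (hG : GoodPhi φ φ' φ'' G) {s : ℝ} (hs : 0 < s) :
    ContinuousAt (gz2 φ φ' φ'') s := by
  have h1 := (hG.2.1 s hs).continuousAt
  have h2 := (hG.2.2.1 s hs).continuousAt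
  have h3 := hG.2.2.2.2.1 s hs
  unfold gz2
  have := hs.ne'
  refine ((h3.div continuousAt_id hs.ne').sub
    ((h2.const_mul 2).div (by fun_prop) (by positivity))).add
    ((h1.const_mul 2).div (by fun_prop) (by positivity))

lemma gz_pos (hN : IsNFunction φ φ') (hG : GoodPhi φ φ' φ'' G) {s : ℝ} (hs : 0 < s) :
    0 < gz φ s := div_pos (phi_pos hN hG hs) hs

lemma gz1_lower (hN : IsNFunction φ φ') (hG : GoodPhi φ φ' φ'' G) {s : ℝ} (hs : 0 < s) :
    gz φ s ≤ G * (s * gz1 φ φ' s) := by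
  have h := phi_lower hN hG hs.le
  have hg := hG.1
  have e : s * gz1 φ φ' s = (s * φ' s - φ s) / s := by unfold gz1; field_simp
  rw [e, gz, mul_div_assoc', div_le_div_iff_of_pos_right hs]
  have : G * ((1 + G⁻¹) * φ s) ≤ G * (s * φ' s) := mul_le_mul_of_nonneg_left h (by linarith)
  have e2 : G * ((1 + G⁻¹) * φ s) = G * φ s + φ s := by field_simp
  linarith

lemma gz1_upper (hN : IsNFunction φ φ') (hG : GoodPhi φ φ' φ'' G) {s : ℝ} (hs : 0 < s) :
    s * gz1 φ φ' s ≤ G * gz φ s := by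
  have h := phi_upper hN hG hs.le
  have e : s * gz1 φ φ' s = (s * φ' s - φ s) / s := by unfold gz1; field_simp
  rw [e, gz, mul_div_assoc', div_le_div_iff_of_pos_right hs]
  linarith

lemma gz2_lower (hN : IsNFunction φ φ') (hG : GoodPhi φ φ' φ'' G) {s : ℝ} (hs : 0 < s) :
    gz φ s ≤ G * (s ^ 2 * gz2 φ φ' φ'' s + 2 * (s * gz1 φ φ' s)) := by
  have h := (hG.2.2.2.2.2 s hs).1
  have h0 := phi_lower hN hG hs.le
  have hg := hG.1
  have hp := phi_pos hN hG hs
  have e : s ^ 2 * gz2 φ φ' φ'' s + 2 * (s * gz1 φ φ' s) = s * φ'' s := by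
    unfold gz1 gz2; field_simp; ring
  rw [e, gz, div_le_iff₀ hs]
  have h2 : φ' s ≤ G * (s * φ'' s) := by
    have := mul_le_mul_of_nonneg_left h (by linarith : 0 ≤ G)
    rwa [← mul_assoc, mul_inv_cancel₀ (by linarith), one_mul] at this
  have h3 : φ s ≤ s * φ' s := by
    have : 0 ≤ G⁻¹ * φ s := by positivity
    linarith
  nlinarith

lemma gz2_abs (hN : IsNFunction φ φ') (hG : GoodPhi φ φ' φ'' G) {s : ℝ} (hs : 0 < s) :
    |s ^ 2 * gz2 φ φ' φ'' s| ≤ (G + 3) ^ 2 * gz φ s := by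
  have h := (hG.2.2.2.2.2 s hs).2
  have hl := (hG.2.2.2.2.2 s hs).1
  have h1 := phi_upper hN hG hs.le
  have hg := hG.1
  have hp := phi_pos hN hG hs
  have hp' := hN.2.2.2.2.1 s hs
  have e : s ^ 2 * gz2 φ φ' φ'' s + 2 * (s * gz1 φ φ' s) = s * φ'' s := by
    unfold gz1 gz2; field_simp; ring
  have hgz := gz_pos hN hG hs
  have hu := gz1_upper hN hG hs
  have hlo := gz1_lower hN hG hs
  have h5 : 0 ≤ s * gz1 φ φ' s := by
    by_contra hc
    push Not at hc
    nlinarith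
  have h6 : φ' s ≤ (1 + G) * gz φ s := by
    rw [gz, mul_div_assoc', le_div_iff₀ hs]; linarith
  have h7 : 0 ≤ s * φ'' s := le_trans (by positivity) hl
  rw [abs_le]
  constructor <;> nlinarith
end phi
end

set_option linter.unusedSectionVars false
noncomputable section

/-! ### The Bellman function -/

lemma bell_quad {G M K a b h1 h2 p q : ℝ} (hG : 1 ≤ G) (hM : M = (G + 3) ^ 2)
    (hK : K = 2 * G * M) (ha : 0 ≤ a) (hb : 0 ≤ b) (hab : a + b = 1)
    (h1l : 1 ≤ G * h1) (h1u : h1 ≤ G) (h2l : 1 ≤ G * (h2 + 2 * h1)) (h2a : |h2| ≤ M) :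
    2 * (q - K * p) * (p + q) * h1 + (b - K * a) * (h2 * (p + q) ^ 2) ≤
      K * (-(p ^ 2 / (4 * G)) + (4 * M + 36 * G * M ^ 2) * q ^ 2) := by
  obtain ⟨h2a1, h2a2⟩ := abs_le.1 h2a
  have hMG : G ≤ M := by rw [hM]; nlinarith
  have hM16 : 16 ≤ M := by rw [hM]; nlinarith
  have hM0 : 0 < M := by linarith
  have hG0 : 0 < G := by linarith
  have hK1 : 1 ≤ K := by rw [hK]; nlinarith
  have ha1 : a ≤ 1 := by linarith
  have hb1 : b ≤ 1 := by linarith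
  have h1p : 0 < h1 := by by_contra hc; push Not at hc; nlinarith
  -- coefficient of p^2
  have c1 : -(K * (2 * h1 + a * h2)) + b * h2 ≤ -(K / (2 * G)) := by
    have e1 : 1 ≤ G * (2 * h1 + a * h2) := by
      have e : G * (2 * h1 + a * h2) = a * (G * (h2 + 2 * h1)) + b * (2 * (G * h1)) := by
        have : b = 1 - a := by linarith
        rw [this]; ring
      rw [e]; nlinarith
    have e2 : b * h2 ≤ M := by nlinarith
    have e3 : K / (2 * G) = M := by rw [hK]; field_simp
    rw [e3]
    have e4 : 2 * M * 1 ≤ 2 * M * (G * (2 * h1 + a * h2)) :=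
      mul_le_mul_of_nonneg_left e1 (by linarith)
    have e5 : K * (2 * h1 + a * h2) = 2 * M * (G * (2 * h1 + a * h2)) := by rw [hK]; ring
    linarith
  have habs : |b - K * a| ≤ K := by
    rw [abs_le]; constructor <;> nlinarith
  have hprod : |(b - K * a) * h2| ≤ K * M := by
    rw [abs_mul]; exact mul_le_mul habs h2a (abs_nonneg _) (by linarith)
  have hKG : K * h1 ≤ K * M := mul_le_mul_of_nonneg_left (by linarith) (by linarith)
  obtain ⟨hp1, hp2⟩ := abs_le.1 hprod
  have c2 : |2 * ((1 - K) * h1 + (b - K * a) * h2)| ≤ 6 * (K * M) := by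
    rw [abs_le]; constructor <;> nlinarith
  have c3 : 2 * h1 + (b - K * a) * h2 ≤ 4 * (K * M) := by nlinarith
  have hpq : 2 * ((1 - K) * h1 + (b - K * a) * h2) * (p * q) ≤ 6 * (K * M) * |p * q| := by
    refine (le_abs_self _).trans ?_
    rw [abs_mul]
    exact mul_le_mul_of_nonneg_right c2 (abs_nonneg _)
  have hy : 6 * M * |p * q| ≤ p ^ 2 / (4 * G) + 36 * G * M ^ 2 * q ^ 2 := by
    have e : p ^ 2 / (4 * G) + 36 * G * M ^ 2 * q ^ 2 - 6 * M * |p * q|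
        = (|p| - 12 * G * M * |q|) ^ 2 / (4 * G) := by
      rw [abs_mul, ← sq_abs p, ← sq_abs q]; field_simp; ring
    have : 0 ≤ (|p| - 12 * G * M * |q|) ^ 2 / (4 * G) := by positivity
    linarith
  have hy2 := mul_le_mul_of_nonneg_left hy (by linarith : 0 ≤ K)
  have c1' := mul_le_mul_of_nonneg_right c1 (sq_nonneg p)
  have c3' := mul_le_mul_of_nonneg_right c3 (sq_nonneg q)
  have e : 2 * (q - K * p) * (p + q) * h1 + (b - K * a) * (h2 * (p + q) ^ 2)
     = (-(K * (2 * h1 + a * h2)) + b * h2) * p ^ 2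
       + 2 * ((1 - K) * h1 + (b - K * a) * h2) * (p * q)
       + (2 * h1 + (b - K * a) * h2) * q ^ 2 := by ring
  rw [e]
  have e6 : K / (2 * G) = 2 * (K / (4 * G)) := by field_simp; ring
  have e7 : K * (p ^ 2 / (4 * G)) = K / (4 * G) * p ^ 2 := by ring
  rw [e6] at c1'
  nlinarith

set_option maxHeartbeats 1000000 in
lemma bell_alg {G M K A B g g1 g2 p q α β : ℝ} (hG : 1 ≤ G) (hM : M = (G + 3) ^ 2)
    (hK : K = 2 * G * M) (hA : 0 < A) (hB : 0 < B) (hg : 0 < g)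
    (h1l : g ≤ G * ((A + B) * g1)) (h1u : (A + B) * g1 ≤ G * g)
    (h2l : g ≤ G * ((A + B) ^ 2 * g2 + 2 * ((A + B) * g1)))
    (h2a : |(A + B) ^ 2 * g2| ≤ M * g) (hα : 0 ≤ α) (hβ : 0 ≤ β) :
    (β / B - K * (α / A)) * g + 2 * (q - K * p) * (p + q) * g1
      + (B - K * A) * (g2 * (p + q) ^ 2 + g1 * (α / A + β / B)) ≤
      g / (A + B) * K *
       (-((p ^ 2 + α) / (4 * G)) + (4 * M + 36 * G * M ^ 2) * (q ^ 2 + β)) := by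
  set s := A + B with hs
  have hs0 : 0 < s := by positivity
  have hMG : G ≤ M := by rw [hM]; nlinarith
  have hM16 : 16 ≤ M := by rw [hM]; nlinarith
  have hM0 : 0 < M := by linarith
  have hG0 : 0 < G := by linarith
  have hK1 : 1 ≤ K := by rw [hK]; nlinarith
  have hg1 : 0 < g1 := by
    by_contra hc; push Not at hc
    have : s * g1 ≤ 0 := by nlinarith
    nlinarith
  have hgs : 0 < g / s := by positivity
  have hq := bell_quad (a := A / s) (b := B / s) (h1 := s * g1 / g) (h2 := s ^ 2 * g2 / g)
    (p := p) (q := q) hG hM hK (by positivity) (by positivity) (by rw [← add_div, ← hs]; field_simp)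
    (by rw [mul_div_assoc', le_div_iff₀ hg]; linarith) (by rw [div_le_iff₀ hg]; exact h1u)
    (by rw [show G * (s ^ 2 * g2 / g + 2 * (s * g1 / g)) = G * (s ^ 2 * g2 + 2 * (s * g1)) / g by
          field_simp, le_div_iff₀ hg]; linarith)
    (by rw [abs_div, abs_of_pos hg, div_le_iff₀ hg]; exact h2a)
  have hq2 := mul_le_mul_of_nonneg_left hq hgs.le
  have eq2 : g / s * (2 * (q - K * p) * (p + q) * (s * g1 / g)
      + (B / s - K * (A / s)) * (s ^ 2 * g2 / g * (p + q) ^ 2))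
      = 2 * (q - K * p) * (p + q) * g1 + (B - K * A) * (g2 * (p + q) ^ 2) := by
    field_simp
  rw [eq2] at hq2
  -- alpha term
  have ta : (-(K * g) + (B - K * A) * g1) / A ≤ g / s * K * (-(1 / (4 * G))) := by
    have e1 : -(K * g) + (B - K * A) * g1 ≤ -((K - G) * g) := by
      have : B * g1 ≤ s * g1 := by nlinarith
      have : 0 ≤ K * A * g1 := by positivity
      nlinarith
    have hKG : K / (4 * G) ≤ K - G := by
      have e3 : K / (4 * G) = M / 2 := by rw [hK]; field_simp; ring
      have e4 : 1 * M ≤ G * M := mul_le_mul_of_nonneg_right hG hM0.le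
      have e5 : G * 1 ≤ G * M := mul_le_mul_of_nonneg_left (by linarith) hG0.le
      rw [e3, hK]; linarith
    have hKG0 : 0 ≤ K - G := le_trans (by positivity) hKG
    calc (-(K * g) + (B - K * A) * g1) / A ≤ -((K - G) * g) / A := by gcongr
      _ = -((K - G) * g / A) := by ring
      _ ≤ -((K - G) * g / s) := by
          have : (K - G) * g / s ≤ (K - G) * g / A := by
            apply div_le_div_of_nonneg_left (by positivity) hA (by linarith)
          linarith
      _ ≤ -(K / (4 * G) * g / s) := by
          have : K / (4 * G) * g / s ≤ (K - G) * g / s := by gcongr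
          linarith
      _ = _ := by ring
  have tb : (g + (B - K * A) * g1) / B ≤ g / s * K * (4 * M + 36 * G * M ^ 2) := by
    rcases le_total B A with h | h
    · have e1 : g + (B - K * A) * g1 ≤ 0 := by
        have e2 : s * g1 ≤ 2 * A * g1 := by nlinarith
        have e3 : B * g1 ≤ A * g1 := by nlinarith
        have e4 : g ≤ 2 * G * (A * g1) := by nlinarith
        have e5 : 2 * G + 1 ≤ K := by rw [hK]; nlinarith
        have e6 : (2 * G + 1) * (A * g1) ≤ K * (A * g1) :=
          mul_le_mul_of_nonneg_right e5 (by positivity)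
        nlinarith
      exact (div_nonpos_of_nonpos_of_nonneg e1 hB.le).trans (by positivity)
    · have e1 : g + (B - K * A) * g1 ≤ (1 + G) * g := by
        have : B * g1 ≤ s * g1 := by nlinarith
        have : 0 ≤ K * A * g1 := by positivity
        nlinarith
      have e2 : g / B ≤ 2 * (g / s) := by
        rw [show 2 * (g / s) = g / (s / 2) by field_simp]
        exact div_le_div_of_nonneg_left hg.le (by positivity) (by linarith)
      calc (g + (B - K * A) * g1) / B ≤ (1 + G) * g / B := by gcongr
        _ = (1 + G) * (g / B) := by ring
        _ ≤ (1 + G) * (2 * (g / s)) := by gcongr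
        _ = g / s * (2 * (1 + G)) := by ring
        _ ≤ g / s * (K * (4 * M + 36 * G * M ^ 2)) := by
          refine mul_le_mul_of_nonneg_left ?_ hgs.le
          have : 0 ≤ 36 * G * M ^ 2 := by positivity
          nlinarith
        _ = _ := by ring
  have ta' := mul_le_mul_of_nonneg_right ta hα
  have tb' := mul_le_mul_of_nonneg_right tb hβ
  have e : (β / B - K * (α / A)) * g + 2 * (q - K * p) * (p + q) * g1
      + (B - K * A) * (g2 * (p + q) ^ 2 + g1 * (α / A + β / B))
      = (2 * (q - K * p) * (p + q) * g1 + (B - K * A) * (g2 * (p + q) ^ 2))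
       + (-(K * g) + (B - K * A) * g1) / A * α + (g + (B - K * A) * g1) / B * β := by
    field_simp; ring
  rw [e]
  have e' : g / s * K * (-((p ^ 2 + α) / (4 * G)) + (4 * M + 36 * G * M ^ 2) * (q ^ 2 + β))
    = g / s * (K * (-(p ^ 2 / (4 * G)) + (4 * M + 36 * G * M ^ 2) * q ^ 2))
      + g / s * K * (-(1 / (4 * G))) * α + g / s * K * (4 * M + 36 * G * M ^ 2) * β := by
    ring
  rw [e']
  linarith

section bell
variable {W : Type*} [NormedAddCommGroup W] [InnerProductSpace ℝ W]

def rootN (δ : ℝ) (w : W) : ℝ := √(δ ^ 2 + ‖w‖ ^ 2)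

lemma rootN_pos {δ : ℝ} (hδ : 0 < δ) (w : W) : 0 < rootN δ w :=
  Real.sqrt_pos.2 (by positivity)

lemma rootN_sq (δ : ℝ) (w : W) : rootN δ w ^ 2 = δ ^ 2 + ‖w‖ ^ 2 :=
  Real.sq_sqrt (by positivity)

lemma rootN_contDiff {δ : ℝ} (hδ : 0 < δ) : ContDiff ℝ 2 (rootN δ : W → ℝ) := by
  unfold rootN
  refine ContDiff.sqrt ?_ (fun x => by positivity)
  exact contDiff_const.add (contDiff_norm_sq ℝ)

lemma rootN_line {δ : ℝ} (hδ : 0 < δ) (w a : W) (t : ℝ) :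
    HasDerivAt (fun t : ℝ => rootN δ (w + t • a)) (inner ℝ (w + t • a) a / rootN δ (w + t • a)) t := by
  have h1 : HasDerivAt (fun t : ℝ => w + t • a) a t := by
    simpa using ((hasDerivAt_id t).smul_const a).const_add w
  have h2 := (h1.norm_sq.const_add (δ ^ 2)).sqrt (by positivity)
  refine h2.congr_deriv ?_
  unfold rootN
  rw [mul_div_mul_left _ _ two_ne_zero]

lemma rootN_line2 {δ : ℝ} (hδ : 0 < δ) (w a : W) :
    HasDerivAt (fun t : ℝ => inner ℝ (w + t • a) a / rootN δ (w + t • a))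
      ((‖a‖ ^ 2 - (inner ℝ w a / rootN δ w) ^ 2) / rootN δ w) 0 := by
  have h1 : HasDerivAt (fun t : ℝ => w + t • a) a 0 := by
    simpa using ((hasDerivAt_id (0:ℝ)).smul_const a).const_add w
  have h2 : HasDerivAt (fun t : ℝ => inner ℝ (w + t • a) a) (‖a‖ ^ 2) 0 := by
    have := h1.inner ℝ (hasDerivAt_const (0:ℝ) a)
    simpa using this
  have h3 := h2.div (rootN_line hδ w a 0) (rootN_pos hδ _).ne'
  refine h3.congr_deriv ?_
  have := (rootN_pos hδ w).ne'
  simp only [zero_smul, add_zero]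
  field_simp

lemma second_line {f : W → ℝ} (hf : ContDiff ℝ 2 f) {w a : W} {h1 : ℝ → ℝ} {h2 : ℝ}
    (H1 : ∀ t, HasDerivAt (fun t : ℝ => f (w + t • a)) (h1 t) t) (H2 : HasDerivAt h1 h2 0) :
    fderiv ℝ (fderiv ℝ f) w a a = h2 := by
  have hl : ∀ t : ℝ, HasDerivAt (fun t : ℝ => w + t • a) a t := fun t => by
    simpa using ((hasDerivAt_id t).smul_const a).const_add w
  have hd : Differentiable ℝ f := hf.differentiable (by norm_num)
  have hd2 : Differentiable ℝ (fderiv ℝ f) :=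
    (hf.fderiv_right (m := 1) (by norm_num)).differentiable (by norm_num)
  have e1 : h1 = fun t => fderiv ℝ f (w + t • a) a := by
    funext t
    exact (H1 t).unique ((hd _).hasFDerivAt.comp_hasDerivAt t (hl t))
  have h3 : HasDerivAt (fun t : ℝ => fderiv ℝ f (w + t • a) a) (fderiv ℝ (fderiv ℝ f) w a a) 0 := by
    have h4 : HasDerivAt (fun t : ℝ => fderiv ℝ f (w + t • a))
        (fderiv ℝ (fderiv ℝ f) (w + (0:ℝ) • a) a) 0 :=
      (hd2 (w + (0:ℝ) • a)).hasFDerivAt.comp_hasDerivAt (0:ℝ) (hl 0)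
    rw [zero_smul, add_zero] at h4
    exact (ContinuousLinearMap.apply ℝ ℝ a).hasFDerivAt.comp_hasDerivAt (0:ℝ) h4
  rw [e1] at H2
  exact h3.unique H2

variable {φ φ' φ'' : ℝ → ℝ} {G : ℝ}

lemma gz_contDiffOn (hG : GoodPhi φ φ' φ'' G) : ContDiffOn ℝ 2 (gz φ) (Ioi 0) := by
  have hd : ∀ s ∈ Ioi (0:ℝ), deriv (gz φ) s = gz1 φ φ' s := fun s hs => (gz_hasDeriv hG hs).deriv
  have hd1 : ∀ s ∈ Ioi (0:ℝ), deriv (gz1 φ φ') s = gz2 φ φ' φ'' s :=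
    fun s hs => (gz1_hasDeriv hG hs).deriv
  rw [show (2 : WithTop ℕ∞) = 1 + 1 by norm_num, contDiffOn_succ_iff_deriv_of_isOpen isOpen_Ioi]
  refine ⟨fun s hs => (gz_hasDeriv hG hs).differentiableAt.differentiableWithinAt, by simp, ?_⟩
  refine ContDiffOn.congr ?_ hd
  rw [show (1 : WithTop ℕ∞) = 0 + 1 by norm_num, contDiffOn_succ_iff_deriv_of_isOpen isOpen_Ioi]
  refine ⟨fun s hs => (gz1_hasDeriv hG hs).differentiableAt.differentiableWithinAt, by simp, ?_⟩
  refine ContDiffOn.congr ?_ hd1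
  rw [contDiffOn_zero]
  exact fun s hs => (gz2_cont hG hs).continuousWithinAt

/-- The Bellman function. -/
def bellU (φ : ℝ → ℝ) (K δ : ℝ) (S : W →L[ℝ] W) (w : W) : ℝ :=
  (rootN δ w - K * rootN δ (S w)) * gz φ (rootN δ (S w) + rootN δ w)

lemma bellU_contDiff (hG : GoodPhi φ φ' φ'' G) (K : ℝ) {δ : ℝ} (hδ : 0 < δ) (S : W →L[ℝ] W) :
    ContDiff ℝ 2 (bellU φ K δ S) := by
  unfold bellU
  have h1 : ContDiff ℝ 2 (rootN δ : W → ℝ) := rootN_contDiff hδ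
  have h2 : ContDiff ℝ 2 (fun w => rootN δ (S w)) := h1.comp S.contDiff
  refine (h1.sub (contDiff_const.mul h2)).mul ?_
  have := (gz_contDiffOn hG).comp (s := univ) (h2.add h1).contDiffOn
    (fun x _ => mem_Ioi.2 (add_pos (rootN_pos hδ _) (rootN_pos hδ _)))
  exact contDiffOn_univ.1 this

lemma bellU_second (hN : IsNFunction φ φ') (hG : GoodPhi φ φ' φ'' G) {M K : ℝ}
    (hM : M = (G + 3) ^ 2) (hK : K = 2 * G * M) {δ : ℝ} (hδ : 0 < δ) (S : W →L[ℝ] W) (w a : W) :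
    fderiv ℝ (fderiv ℝ (bellU φ K δ S)) w a a ≤
      gz φ (rootN δ (S w) + rootN δ w) / (rootN δ (S w) + rootN δ w) * K *
      (-(‖S a‖ ^ 2 / (4 * G)) + (4 * M + 36 * G * M ^ 2) * ‖a‖ ^ 2) := by
  have hA := rootN_pos hδ (S w)
  have hB := rootN_pos hδ w
  have HA1 : ∀ t : ℝ, HasDerivAt (fun t : ℝ => rootN δ (S (w + t • a)))
      (inner ℝ (S w + t • S a) (S a) / rootN δ (S w + t • S a)) t := by
    intro t
    simpa using rootN_line hδ (S w) (S a) t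
  have HB1 := rootN_line hδ w a
  have HA2 := rootN_line2 hδ (S w) (S a)
  have HB2 := rootN_line2 hδ w a
  have Hs : ∀ t : ℝ, HasDerivAt (fun t : ℝ => gz φ (rootN δ (S (w + t • a)) + rootN δ (w + t • a)))
      (gz1 φ φ' (rootN δ (S (w + t • a)) + rootN δ (w + t • a)) *
        (inner ℝ (S w + t • S a) (S a) / rootN δ (S w + t • S a)
          + inner ℝ (w + t • a) a / rootN δ (w + t • a))) t := fun t =>
    HasDerivAt.comp (h₂ := gz φ)
      (h := fun t : ℝ => rootN δ (S (w + t • a)) + rootN δ (w + t • a)) t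
      (gz_hasDeriv hG (add_pos (rootN_pos hδ (S (w + t • a))) (rootN_pos hδ (w + t • a))))
      ((HA1 t).add (HB1 t))
  have Hs1 : HasDerivAt (fun t : ℝ => gz1 φ φ' (rootN δ (S (w + t • a)) + rootN δ (w + t • a)))
      (gz2 φ φ' φ'' (rootN δ (S (w + (0:ℝ) • a)) + rootN δ (w + (0:ℝ) • a)) *
        (inner ℝ (S w + (0:ℝ) • S a) (S a) / rootN δ (S w + (0:ℝ) • S a)
          + inner ℝ (w + (0:ℝ) • a) a / rootN δ (w + (0:ℝ) • a))) 0 :=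
    HasDerivAt.comp (h₂ := gz1 φ φ')
      (h := fun t : ℝ => rootN δ (S (w + t • a)) + rootN δ (w + t • a)) 0
      (gz1_hasDeriv hG (add_pos (rootN_pos hδ (S (w + (0:ℝ) • a)))
      (rootN_pos hδ (w + (0:ℝ) • a)))) ((HA1 0).add (HB1 0))
  have H1 : ∀ t : ℝ, HasDerivAt (fun t : ℝ => bellU φ K δ S (w + t • a)) _ t := fun t =>
    ((HB1 t).sub ((HA1 t).const_mul K)).mul (Hs t)
  have H2 := ((HB2.sub (HA2.const_mul K)).mul (Hs 0)).add
        (((HB1 0).sub ((HA1 0).const_mul K)).mul (Hs1.mul (HA2.add HB2)))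
  have e := second_line (bellU_contDiff hG K hδ S) (w := w) (a := a) H1 H2
  rw [e]
  simp only [zero_smul, add_zero, Pi.add_apply, Pi.sub_apply, Pi.mul_apply]
  have hcs : ∀ v b : W, (inner ℝ v b / rootN δ v) ^ 2 ≤ ‖b‖ ^ 2 := by
    intro v b
    rw [div_pow, div_le_iff₀ (by have := rootN_pos hδ v; positivity), rootN_sq]
    have h1 := abs_real_inner_le_norm v b
    have h2 : (inner ℝ v b) ^ 2 ≤ (‖v‖ * ‖b‖) ^ 2 := sq_le_sq' (by
      have := neg_abs_le (inner ℝ v b : ℝ); linarith) ((le_abs_self _).trans h1)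
    nlinarith [mul_nonneg (sq_nonneg ‖b‖) (sq_nonneg δ)]
  have hs := add_pos hA hB
  have := bell_alg (p := inner ℝ (S w) (S a) / rootN δ (S w)) (q := inner ℝ w a / rootN δ w)
    (α := ‖S a‖ ^ 2 - (inner ℝ (S w) (S a) / rootN δ (S w)) ^ 2)
    (β := ‖a‖ ^ 2 - (inner ℝ w a / rootN δ w) ^ 2)
    hG.1 hM hK hA hB (gz_pos hN hG hs) (gz1_lower hN hG hs) (gz1_upper hN hG hs)
    (gz2_lower hN hG hs) (by rw [hM]; exact gz2_abs hN hG hs) (sub_nonneg.2 (hcs _ _))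
    (sub_nonneg.2 (hcs _ _))
  simp only [add_sub_cancel] at this
  refine le_trans (le_of_eq ?_) this
  ring

end bell
end

noncomputable section
set_option linter.unusedSectionVars false
section heat
open scoped Topology

variable {E : Type*} [NormedAddCommGroup E] [InnerProductSpace ℝ E] [FiniteDimensional ℝ E]
  [MeasurableSpace E] [BorelSpace E]

/-- Gaussian weight. -/
def gw (z : E) : ℝ := rexp (-π * ‖z‖ ^ 2)

lemma gw_pos (z : E) : 0 < gw z := exp_pos _

lemma gw_le_one (z : E) : gw z ≤ 1 := by
  unfold gw
  rw [exp_le_one_iff]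
  have := pi_pos
  nlinarith [sq_nonneg ‖z‖, mul_nonneg pi_pos.le (sq_nonneg ‖z‖)]

lemma gw_cont : Continuous (gw : E → ℝ) := by unfold gw; fun_prop

lemma gw_integral : ∫ z : E, gw z = 1 := by
  have := GaussianFourier.integral_rexp_neg_mul_sq_norm (V := E) pi_pos
  rw [div_self pi_pos.ne', one_rpow] at this
  exact this

lemma gw_integrable : Integrable (gw : E → ℝ) := by
  by_contra h
  have := integral_undef h
  rw [gw_integral] at this
  norm_num at this

lemma gw_moment : Integrable (fun z : E => gw z * (1 + ‖z‖)) := by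
  have h1 : Integrable (fun z : E => rexp (-1 * ‖z‖ ^ 2)) := by
    by_contra h
    have := integral_undef h
    rw [GaussianFourier.integral_rexp_neg_mul_sq_norm (V := E) one_pos] at this
    have h2 : 0 < (π / 1) ^ (Module.finrank ℝ E / 2 : ℝ) := by positivity
    linarith
  refine (h1.const_mul 2).mono' ((gw_cont.mul (by fun_prop)).aestronglyMeasurable)
    (Eventually.of_forall fun z => ?_)
  rw [norm_of_nonneg (mul_nonneg (gw_pos z).le (by positivity))]
  have h3 : 1 + ‖z‖ ≤ 2 * rexp (‖z‖ ^ 2) := by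
    have := add_one_le_exp (‖z‖ ^ 2)
    nlinarith [sq_nonneg (‖z‖ - 1), sq_nonneg ‖z‖]
  have h4 : gw z * rexp (‖z‖ ^ 2) ≤ rexp (-1 * ‖z‖ ^ 2) := by
    unfold gw
    rw [← exp_add]
    apply exp_le_exp.2
    nlinarith [pi_gt_three, sq_nonneg ‖z‖]
  nlinarith [gw_pos z, mul_le_mul_of_nonneg_left h3 (gw_pos z).le]

lemma gw_line (z v : E) : HasLineDerivAt ℝ gw (-(2 * π * inner ℝ z v) * gw z) z v := by
  unfold HasLineDerivAt gw
  have h1 : HasDerivAt (fun t : ℝ => ‖z + t • v‖ ^ 2) (2 * inner ℝ (z + (0:ℝ) • v) v) 0 := by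
    have h0 : HasDerivAt (fun t : ℝ => z + t • v) v 0 := by
      simpa using ((hasDerivAt_id (0:ℝ)).smul_const v).const_add z
    exact h0.norm_sq
  have h2 := (h1.const_mul (-π)).exp
  have e : rexp (-π * ‖z + (0:ℝ) • v‖ ^ 2) * (-π * (2 * inner ℝ (z + (0:ℝ) • v) v)) =
      -(2 * π * inner ℝ z v) * rexp (-π * ‖z‖ ^ 2) := by
    rw [zero_smul, add_zero]
    ring
  rw [e] at h2
  exact h2

variable {F : Type*} [NormedAddCommGroup F] [NormedSpace ℝ F]

/-- Gaussian average of `f` at scale `s`. -/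
def avg (f : E → F) (s : ℝ) (x : E) : F := ∫ z : E, gw z • f (x + s • z)

lemma avg_zero [CompleteSpace F] (f : E → F) (x : E) : avg f 0 x = f x := by
  simp [avg, integral_smul_const, gw_integral]

lemma avg_integrand {f : E → F} (hf : Continuous f) {C : ℝ} (hC : ∀ x, ‖f x‖ ≤ C) (s : ℝ) (x : E) :
    Integrable (fun z : E => gw z • f (x + s • z)) := by
  refine (gw_integrable.mul_const C).mono' (gw_cont.smul (by fun_prop)).aestronglyMeasurable
    (Eventually.of_forall fun z => ?_)
  rw [norm_smul, norm_of_nonneg (gw_pos z).le]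
  exact mul_le_mul_of_nonneg_left (hC _) (gw_pos z).le

lemma avg_cont {f : E → F} (hf : Continuous f) {C : ℝ} (hC : ∀ x, ‖f x‖ ≤ C) :
    Continuous (fun p : ℝ × E => avg f p.1 p.2) := by
  unfold avg
  refine continuous_of_dominated (bound := fun z => gw z * C)
    (fun p => (gw_cont.smul (by fun_prop)).aestronglyMeasurable) (fun p => ?_)
    (gw_integrable.mul_const C) (Eventually.of_forall fun z => by fun_prop)
  refine Eventually.of_forall fun z => ?_
  rw [norm_smul, norm_of_nonneg (gw_pos z).le]
  exact mul_le_mul_of_nonneg_left (hC _) (gw_pos z).le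

lemma avg_bound {f : E → F} {C : ℝ} (hC : ∀ x, ‖f x‖ ≤ C) (s : ℝ) (x : E) :
    ‖avg f s x‖ ≤ C := by
  have h : ‖avg f s x‖ ≤ ∫ z : E, gw z * C := by
    refine norm_integral_le_of_norm_le (gw_integrable.mul_const C) (Eventually.of_forall fun z => ?_)
    rw [norm_smul, norm_of_nonneg (gw_pos z).le]
    exact mul_le_mul_of_nonneg_left (hC _) (gw_pos z).le
  rwa [integral_mul_const, gw_integral, one_mul] at h

lemma avg_prod_integrable {f : E → F} (hf : Integrable f) (hc : Continuous f) (s : ℝ) :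
    Integrable (fun p : E × E => gw p.2 • f (p.1 + s • p.2)) (volume.prod volume) := by
  have hm : Continuous (fun p : E × E => gw p.2 • f (p.1 + s • p.2)) :=
    (gw_cont.comp continuous_snd).smul (by fun_prop)
  rw [integrable_prod_iff' hm.aestronglyMeasurable]
  constructor
  · exact Eventually.of_forall fun z => (hf.comp_add_right (s • z)).smul (gw z)
  · simp only [norm_smul, integral_const_mul]
    have : (fun z : E => ‖gw z‖ * ∫ x : E, ‖f (x + s • z)‖) = fun z => gw z * ∫ x : E, ‖f x‖ := by
      ext z
      rw [norm_of_nonneg (gw_pos z).le, integral_add_right_eq_self (fun x => ‖f x‖)]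
    rw [this]
    exact gw_integrable.mul_const _

lemma avg_integrable {f : E → F} (hf : Integrable f) (hc : Continuous f) (s : ℝ) :
    Integrable (avg f s) :=
  (avg_prod_integrable hf hc s).integral_prod_left

lemma avg_L1 {f : E → F} (hf : Integrable f) (hc : Continuous f) (s : ℝ) :
    ∫ x, ‖avg f s x‖ ≤ ∫ x, ‖f x‖ := by
  have hp := (avg_prod_integrable hf hc s).norm
  calc ∫ x, ‖avg f s x‖ ≤ ∫ x, ∫ z, ‖gw z • f (x + s • z)‖ :=
        integral_mono (avg_integrable hf hc s).norm hp.integral_prod_left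
          fun x => norm_integral_le_integral_norm _
    _ = ∫ z : E, ∫ x : E, ‖gw z • f (x + s • z)‖ := integral_integral_swap hp
    _ = ∫ z : E, gw z * ∫ x, ‖f x‖ := by
        congr 1; ext z
        simp only [norm_smul, integral_const_mul]
        rw [norm_of_nonneg (gw_pos z).le, integral_add_right_eq_self (fun x => ‖f x‖)]
    _ = ∫ x, ‖f x‖ := by rw [integral_mul_const, gw_integral, one_mul]

lemma avg_decay {f : E → F} (hf : Integrable f) {s : ℝ} (hs : 0 < s) (x : E) :
    ‖avg f s x‖ ≤ (s ^ Module.finrank ℝ E)⁻¹ * ∫ x, ‖f x‖ := by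
  have h1 : ∫ z : E, ‖f (x + s • z)‖ = (s ^ Module.finrank ℝ E)⁻¹ * ∫ x, ‖f x‖ := by
    have := Measure.integral_comp_smul (volume : Measure E) (fun y => ‖f (x + y)‖) s
    rw [this, abs_of_pos (by positivity), integral_add_left_eq_self (fun y => ‖f y‖), smul_eq_mul]
  rw [← h1]
  have hi : Integrable (fun z : E => ‖f (x + s • z)‖) :=
    ((hf.comp_add_left x).comp_smul hs.ne').norm
  refine norm_integral_le_of_norm_le hi (Eventually.of_forall fun z => ?_)
  rw [norm_smul, norm_of_nonneg (gw_pos z).le]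
  exact mul_le_of_le_one_left (norm_nonneg _) (gw_le_one z)

/-- Derivative of the average along a path in `(s, x)`. -/
lemma avg_deriv {f : E → F} (hf : ContDiff ℝ 1 f) {C C' : ℝ} (hC : ∀ x, ‖f x‖ ≤ C)
    (hC' : ∀ x, ‖fderiv ℝ f x‖ ≤ C') (s τ : ℝ) (x v : E) :
    HasDerivAt (fun t : ℝ => avg f (s + t * τ) (x + t • v))
      (∫ z : E, gw z • fderiv ℝ f (x + s • z) (v + τ • z)) 0 := by
  unfold avg
  have hC'0 : 0 ≤ C' := (norm_nonneg _).trans (hC' 0)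
  have key := hasDerivAt_integral_of_dominated_loc_of_deriv_le (μ := (volume : Measure E))
    (F := fun t z => gw z • f (x + t • v + (s + t * τ) • z))
    (F' := fun t z => gw z • fderiv ℝ f (x + t • v + (s + t * τ) • z) (v + τ • z))
    (x₀ := (0:ℝ)) (s := univ) (bound := fun z => (gw z * (1 + ‖z‖)) * (C' * (‖v‖ + |τ|)))
    univ_mem (Eventually.of_forall fun t =>
      (avg_integrand hf.continuous hC _ _).aestronglyMeasurable)
    (avg_integrand hf.continuous hC _ _) ?_ ?_ (gw_moment.mul_const _) ?_
  · simpa using key.2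
  · refine (gw_cont.smul ?_).aestronglyMeasurable
    have := hf.continuous_fderiv one_ne_zero
    exact (this.comp (by fun_prop)).clm_apply (by fun_prop)
  · refine Eventually.of_forall fun z t _ => ?_
    rw [norm_smul, norm_of_nonneg (gw_pos z).le, mul_assoc]
    refine mul_le_mul_of_nonneg_left ?_ (gw_pos z).le
    refine (ContinuousLinearMap.le_opNorm _ _).trans ?_
    have h1 : ‖v + τ • z‖ ≤ ‖v‖ + |τ| * ‖z‖ := by
      refine (norm_add_le _ _).trans ?_
      rw [norm_smul, norm_eq_abs]
    calc _ ≤ C' * (‖v‖ + |τ| * ‖z‖) := mul_le_mul (hC' _) h1 (norm_nonneg _) hC'0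
      _ ≤ C' * ((1 + ‖z‖) * (‖v‖ + |τ|)) := by
        refine mul_le_mul_of_nonneg_left ?_ hC'0
        nlinarith [norm_nonneg z, norm_nonneg v, abs_nonneg τ, mul_nonneg (norm_nonneg z) (norm_nonneg v)]
      _ = _ := by ring
  · refine Eventually.of_forall fun z t _ => ?_
    have h1 : HasDerivAt (fun t : ℝ => x + t • v + (s + t * τ) • z) (v + τ • z) t := by
      have a1 : HasDerivAt (fun t : ℝ => x + t • v) v t := by
        simpa using ((hasDerivAt_id t).smul_const v).const_add x
      have a2 : HasDerivAt (fun t : ℝ => s + t * τ) τ t := by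
        simpa using ((hasDerivAt_id t).mul_const τ).const_add s
      exact a1.add (a2.smul_const z)
    have h2 := ((hf.differentiable one_ne_zero) (x + t • v + (s + t * τ) • z)).hasFDerivAt
    exact (h2.comp_hasDerivAt t h1).const_smul (gw z)

lemma avg_line {f : E → F} (hf : ContDiff ℝ 1 f) {C C' : ℝ} (hC : ∀ x, ‖f x‖ ≤ C)
    (hC' : ∀ x, ‖fderiv ℝ f x‖ ≤ C') (s : ℝ) (x v : E) :
    HasLineDerivAt ℝ (avg f s) (avg (fun y => fderiv ℝ f y v) s x) x v := by
  have := avg_deriv hf hC hC' s 0 x v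
  simpa [HasLineDerivAt, avg] using this

lemma avg_time {f : E → F} (hf : ContDiff ℝ 1 f) {C C' : ℝ} (hC : ∀ x, ‖f x‖ ≤ C)
    (hC' : ∀ x, ‖fderiv ℝ f x‖ ≤ C') (s : ℝ) (x : E) :
    HasDerivAt (fun s => avg f s x) (∫ z : E, gw z • fderiv ℝ f (x + s • z) z) s := by
  have := avg_deriv hf hC hC' s 1 x 0
  simp only [mul_one, smul_zero, add_zero, one_smul, zero_add] at this
  have h2 : HasDerivAt (fun t : ℝ => t - s) 1 s := (hasDerivAt_id s).sub_const s
  have h3 := HasDerivAt.scomp (g₁ := fun t => avg f (s + t) x) (h := fun t => t - s) s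
    (by simpa using this) h2
  simpa [Function.comp_def] using h3

end heat
end

noncomputable section
set_option linter.unusedSectionVars false
section heat2
open scoped Topology

section
variable {E : Type*} [NormedAddCommGroup E] [InnerProductSpace ℝ E] [FiniteDimensional ℝ E]
  [MeasurableSpace E] [BorelSpace E]
variable {F : Type*} [NormedAddCommGroup F] [NormedSpace ℝ F]

lemma avg_ibp {h : E → F} (hf : ContDiff ℝ 1 h) {C C' : ℝ} (hC : ∀ x, ‖h x‖ ≤ C)
    (hC' : ∀ x, ‖fderiv ℝ h x‖ ≤ C') (s : ℝ) (x v : E) :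
    ∫ z : E, (2 * π * inner ℝ z v * gw z) • h (x + s • z) =
      s • avg (fun y => fderiv ℝ h y v) s x := by
  have hC0 : 0 ≤ C := (norm_nonneg _).trans (hC 0)
  have i1 : Integrable (fun z : E => (-(2 * π * inner ℝ z v) * gw z) • h (x + s • z)) := by
    refine (gw_moment.mul_const (2 * π * ‖v‖ * C)).mono' ?_ (Eventually.of_forall fun z => ?_)
    · have := hf.continuous
      have h2 : Continuous (gw : E → ℝ) := gw_cont
      exact Continuous.aestronglyMeasurable (by fun_prop)
    · rw [norm_smul, norm_mul, norm_neg, norm_mul, norm_of_nonneg (gw_pos z).le,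
        norm_of_nonneg (by positivity : 0 ≤ 2 * π)]
      have h1 : ‖(inner ℝ z v : ℝ)‖ ≤ (1 + ‖z‖) * ‖v‖ := by
        refine (norm_inner_le_norm z v).trans ?_
        nlinarith [norm_nonneg v]
      have := gw_pos z
      calc _ ≤ 2 * π * ((1 + ‖z‖) * ‖v‖) * gw z * C := by
            gcongr
            exact hC _
        _ = _ := by ring
  have i2 : Integrable (fun z : E => gw z • (s • fderiv ℝ h (x + s • z) v)) :=
    avg_integrand (f := fun y => s • fderiv ℝ h y v) (C := |s| * (C' * ‖v‖))
      (((hf.continuous_fderiv one_ne_zero).clm_apply continuous_const).const_smul s)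
      (fun y => by
        rw [norm_smul, norm_eq_abs]
        refine mul_le_mul_of_nonneg_left ?_ (abs_nonneg s)
        exact (ContinuousLinearMap.le_opNorm _ _).trans
          (mul_le_mul_of_nonneg_right (hC' y) (norm_nonneg v))) s x
  have i3 := avg_integrand hf.continuous hC s x
  have key := integral_bilinear_hasLineDerivAt_right_eq_neg_left_of_integrable
    (μ := (volume : Measure E)) (B := ContinuousLinearMap.lsmul ℝ ℝ) (v := v)
    (f := (gw : E → ℝ)) (f' := fun z => -(2 * π * inner ℝ z v) * gw z)
    (g := fun z => h (x + s • z)) (g' := fun z => s • fderiv ℝ h (x + s • z) v)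
    i1 i2 i3
    (fun z _ => gw_line z v) (fun z _ => ?_)
  · simp only [ContinuousLinearMap.lsmul_apply, neg_mul, neg_smul, integral_neg, neg_neg] at key
    rw [← key]
    simp only [smul_comm _ s, integral_smul]
    rfl
  · have h1 : HasDerivAt (fun t : ℝ => x + s • (z + t • v)) (s • v) 0 := by
      have := ((((hasDerivAt_id (0:ℝ)).smul_const v).const_add z).const_smul s).const_add x
      simpa using this
    have h2 := ((hf.differentiable one_ne_zero) (x + s • (z + (0:ℝ) • v))).hasFDerivAt
    have := h2.comp_hasDerivAt (0:ℝ) h1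
    simpa [HasLineDerivAt, Function.comp_def] using this

end

variable {d : ℕ} {W : Type*} [NormedAddCommGroup W] [NormedSpace ℝ W] [FiniteDimensional ℝ W]
local notation "𝔼" => EuclideanSpace ℝ (Fin d)

/-- partial derivative -/
def pd (k : Fin d) (f : 𝔼 → W) (y : 𝔼) : W := fderiv ℝ f y (EuclideanSpace.single k 1)

lemma pd_contDiff {n : ℕ} (k : Fin d) {f : 𝔼 → W} (hf : ContDiff ℝ (n + 1 : ℕ) f) :
    ContDiff ℝ n (pd k f) := by
  unfold pd
  exact (hf.fderiv_right (m := n) (by norm_cast)).clm_apply contDiff_const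

lemma pd_supp (k : Fin d) {f : 𝔼 → W} (hf : HasCompactSupport f) :
    HasCompactSupport (pd k f) := hf.fderiv_apply ℝ _

lemma avg_time' {f : 𝔼 → W} (hf : ContDiff ℝ 2 f) (hs : HasCompactSupport f) (s : ℝ) (x : 𝔼) :
    HasDerivAt (fun s => avg f s x) ((s / (2 * π)) • ∑ k, avg (pd k (pd k f)) s x) s := by
  have hf1 : ContDiff ℝ 1 f := hf.of_le (by norm_num)
  obtain ⟨C, hC⟩ := hs.exists_bound_of_continuous hf.continuous
  obtain ⟨C', hC'⟩ := (hs.fderiv ℝ).exists_bound_of_continuous (hf1.continuous_fderiv one_ne_zero)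
  have h0 := avg_time hf1 hC hC' s x
  convert h0 using 1
  have hk1 : ∀ k : Fin d, ContDiff ℝ 1 (pd k f) := fun k => pd_contDiff (n := 1) k hf
  have hk : ∀ k : Fin d, ∫ z : 𝔼, (2 * π * inner ℝ z (EuclideanSpace.single k (1:ℝ)) * gw z) •
      pd k f (x + s • z) = s • avg (pd k (pd k f)) s x := by
    intro k
    obtain ⟨D, hD⟩ := (pd_supp k hs).exists_bound_of_continuous (hk1 k).continuous
    obtain ⟨D', hD'⟩ := ((pd_supp k hs).fderiv ℝ).exists_bound_of_continuous
      ((hk1 k).continuous_fderiv one_ne_zero)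
    exact avg_ibp (hk1 k) hD hD' s x _
  have hint : ∀ k : Fin d, Integrable (fun z : 𝔼 => (z k * gw z) • pd k f (x + s • z)) := by
    intro k
    obtain ⟨D, hD⟩ := (pd_supp k hs).exists_bound_of_continuous (hk1 k).continuous
    refine (gw_moment.mul_const D).mono' ?_ (Eventually.of_forall fun z => ?_)
    · have h2 : Continuous (gw : 𝔼 → ℝ) := gw_cont
      have h3 := (hk1 k).continuous
      exact Continuous.aestronglyMeasurable (by fun_prop)
    · rw [norm_smul, norm_mul, norm_of_nonneg (gw_pos z).le]
      have h1 : ‖z k‖ ≤ 1 + ‖z‖ := by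
        have := PiLp.norm_apply_le z k
        linarith
      have := gw_pos z
      have := hD (x + s • z)
      rw [mul_comm (gw z)]
      gcongr
  have hz : ∀ z : 𝔼, gw z • fderiv ℝ f (x + s • z) z =
      ∑ k, (z k * gw z) • pd k f (x + s • z) := by
    intro z
    have e : z = ∑ k, z k • EuclideanSpace.single k (1:ℝ) := by
      ext i
      simp [Finset.sum_apply, Pi.single_apply]
    conv_lhs => rw [e, map_sum, ← e, Finset.smul_sum]
    refine Finset.sum_congr rfl fun k _ => ?_
    rw [map_smul, smul_smul, mul_comm]
    rfl
  simp only [hz]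
  rw [integral_finsetSum _ (fun k _ => hint k), Finset.smul_sum]
  refine Finset.sum_congr rfl fun k _ => ?_
  have e2 : s / (2 * π) = (2 * π)⁻¹ * s := by ring
  rw [e2, mul_smul, ← hk k, ← integral_smul]
  congr 1
  ext1 z
  rw [smul_smul]
  congr 1
  have : (inner ℝ z (EuclideanSpace.single k (1:ℝ)) : ℝ) = z k := by
    simp [EuclideanSpace.inner_single_right]
  rw [this]
  have := pi_pos
  field_simp

end heat2
end

noncomputable section
set_option linter.unusedSectionVars false
section heat3
open scoped Topology

variable {d : ℕ} {W : Type*} [NormedAddCommGroup W] [NormedSpace ℝ W] [FiniteDimensional ℝ W]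
local notation "𝔼" => EuclideanSpace ℝ (Fin d)

lemma heat_mono {f : 𝔼 → W} (hf : ContDiff ℝ 2 f) (hs : HasCompactSupport f)
    {U : W → ℝ} (hU : ContDiff ℝ 2 U)
    (H : ∀ s x, ∑ k, fderiv ℝ (fderiv ℝ U) (avg f s x) (avg (pd k f) s x) (avg (pd k f) s x) ≤ 0)
    (s : ℝ) : 0 ≤ ∫ x, fderiv ℝ U (avg f s x) (∑ k, avg (pd k (pd k f)) s x) := by
  have hf1 : ContDiff ℝ 1 f := hf.of_le (by norm_num)
  have hU1 : ContDiff ℝ 1 U := hU.of_le (by norm_num)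
  have hdU : ContDiff ℝ 1 (fderiv ℝ U) := hU.fderiv_right (by norm_num)
  obtain ⟨C, hC⟩ := hs.exists_bound_of_continuous hf.continuous
  obtain ⟨C', hC'⟩ := (hs.fderiv ℝ).exists_bound_of_continuous (hf1.continuous_fderiv one_ne_zero)
  have hk1 : ∀ k : Fin d, ContDiff ℝ 1 (pd k f) := fun k => pd_contDiff (n := 1) k hf
  have hks : ∀ k : Fin d, HasCompactSupport (pd k f) := fun k => pd_supp k hs
  have hkk : ∀ k : Fin d, Continuous (pd k (pd k f)) := fun k =>
    (pd_contDiff (n := 0) k (hk1 k)).continuous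
  have hkks : ∀ k : Fin d, HasCompactSupport (pd k (pd k f)) := fun k => pd_supp k (hks k)
  have hcp := isCompact_closedBall (0 : W) C
  obtain ⟨D1, hD1⟩ := hcp.exists_bound_of_continuousOn
    (hU1.continuous_fderiv one_ne_zero).continuousOn
  obtain ⟨D2, hD2⟩ := hcp.exists_bound_of_continuousOn
    (hdU.continuous_fderiv one_ne_zero).continuousOn
  have hmem : ∀ x, avg f s x ∈ Metric.closedBall (0 : W) C := fun x => by
    simpa using avg_bound hC s x
  have cN : Continuous (avg f s) := (avg_cont hf.continuous hC).comp (Continuous.prodMk_right s)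
  have cNk : ∀ k, Continuous (avg (pd k f) s) := fun k => by
    obtain ⟨D, hD⟩ := (hks k).exists_bound_of_continuous (hk1 k).continuous
    exact (avg_cont (hk1 k).continuous hD).comp (Continuous.prodMk_right s)
  have cNkk : ∀ k, Continuous (avg (pd k (pd k f)) s) := fun k => by
    obtain ⟨D, hD⟩ := (hkks k).exists_bound_of_continuous (hkk k)
    exact (avg_cont (hkk k) hD).comp (Continuous.prodMk_right s)
  have iNk : ∀ k, Integrable (avg (pd k f) s) := fun k =>
    avg_integrable ((hk1 k).continuous.integrable_of_hasCompactSupport (hks k)) (hk1 k).continuous s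
  have iNkk : ∀ k, Integrable (avg (pd k (pd k f)) s) := fun k =>
    avg_integrable ((hkk k).integrable_of_hasCompactSupport (hkks k)) (hkk k) s
  have c1 : Continuous (fun x => fderiv ℝ U (avg f s x)) :=
    (hU1.continuous_fderiv one_ne_zero).comp cN
  have c2 : Continuous (fun x => fderiv ℝ (fderiv ℝ U) (avg f s x)) :=
    (hdU.continuous_fderiv one_ne_zero).comp cN
  have I1 : ∀ {g : 𝔼 → W}, Continuous g → Integrable g →
      Integrable (fun x => fderiv ℝ U (avg f s x) (g x)) := fun {g} hg hi => by
    refine (hi.norm.const_mul D1).mono' (c1.clm_apply hg).aestronglyMeasurable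
      (Eventually.of_forall fun x => ?_)
    exact (ContinuousLinearMap.le_opNorm _ _).trans
      (mul_le_mul_of_nonneg_right (hD1 _ (hmem x)) (norm_nonneg _))
  have I2 : ∀ k, Integrable (fun x => fderiv ℝ (fderiv ℝ U) (avg f s x) (avg (pd k f) s x)
      (avg (pd k f) s x)) := fun k => by
    obtain ⟨D, hD⟩ := (hks k).exists_bound_of_continuous (hk1 k).continuous
    have hD0 : 0 ≤ D := (norm_nonneg _).trans (hD 0)
    have hD20 : 0 ≤ D2 := (norm_nonneg _).trans (hD2 _ (hmem 0))
    refine ((iNk k).norm.const_mul (D2 * D)).mono'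
      ((c2.clm_apply (cNk k)).clm_apply (cNk k)).aestronglyMeasurable
      (Eventually.of_forall fun x => ?_)
    refine (ContinuousLinearMap.le_opNorm₂ _ _ _).trans ?_
    have h1 := avg_bound hD s x
    have h2 := hD2 _ (hmem x)
    gcongr
  have ibp : ∀ k, ∫ x, fderiv ℝ U (avg f s x) (avg (pd k (pd k f)) s x) =
      - ∫ x, fderiv ℝ (fderiv ℝ U) (avg f s x) (avg (pd k f) s x) (avg (pd k f) s x) := by
    intro k
    obtain ⟨D, hD⟩ := (hks k).exists_bound_of_continuous (hk1 k).continuous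
    obtain ⟨D', hD'⟩ := ((hks k).fderiv ℝ).exists_bound_of_continuous
      ((hk1 k).continuous_fderiv one_ne_zero)
    refine integral_bilinear_hasLineDerivAt_right_eq_neg_left_of_integrable
      (μ := (volume : Measure 𝔼)) (B := ContinuousLinearMap.id ℝ (W →L[ℝ] ℝ))
      (v := EuclideanSpace.single k (1:ℝ))
      (f := fun x => fderiv ℝ U (avg f s x))
      (f' := fun x => fderiv ℝ (fderiv ℝ U) (avg f s x) (avg (pd k f) s x))
      (g := avg (pd k f) s) (g' := avg (pd k (pd k f)) s)
      (I2 k) (I1 (cNkk k) (iNkk k)) (I1 (cNk k) (iNk k)) (fun x _ => ?_) (fun x _ => ?_)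
    · have h1 : HasLineDerivAt ℝ (avg f s) (avg (pd k f) s x) x (EuclideanSpace.single k (1:ℝ)) :=
        avg_line hf1 hC hC' s x (EuclideanSpace.single k (1:ℝ))
      have h2 := ((hdU.differentiable one_ne_zero)
        (avg f s (x + (0:ℝ) • EuclideanSpace.single k (1:ℝ)))).hasFDerivAt
      have := h2.comp_hasDerivAt (0:ℝ) h1
      simpa [HasLineDerivAt, Function.comp_def] using this
    · exact avg_line (hk1 k) hD hD' s x _
  simp only [map_sum]
  rw [integral_finsetSum _ (fun k _ => I1 (cNkk k) (iNkk k))]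
  simp only [ibp, Finset.sum_neg_distrib]
  rw [← integral_finsetSum _ (fun k _ => I2 k), ← integral_neg]
  exact integral_nonneg fun x => neg_nonneg.2 (H s x)

lemma heat_cmp {f : 𝔼 → W} (hf : ContDiff ℝ 2 f) (hs : HasCompactSupport f)
    {U : W → ℝ} (hU : ContDiff ℝ 2 U)
    (H : ∀ s x, ∑ k, fderiv ℝ (fderiv ℝ U) (avg f s x) (avg (pd k f) s x) (avg (pd k f) s x) ≤ 0)
    {T : ℝ} (hT : 0 ≤ T) : 0 ≤ ∫ x, (U (avg f T x) - U (f x)) := by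
  have hU1 : ContDiff ℝ 1 U := hU.of_le (by norm_num)
  obtain ⟨C, hC⟩ := hs.exists_bound_of_continuous hf.continuous
  have hk1 : ∀ k : Fin d, ContDiff ℝ 1 (pd k f) := fun k => pd_contDiff (n := 1) k hf
  have hkk : ∀ k : Fin d, Continuous (pd k (pd k f)) := fun k =>
    (pd_contDiff (n := 0) k (hk1 k)).continuous
  have hkks : ∀ k : Fin d, HasCompactSupport (pd k (pd k f)) := fun k => pd_supp k (pd_supp k hs)
  have hcp := isCompact_closedBall (0 : W) C
  obtain ⟨D1, hD1⟩ := hcp.exists_bound_of_continuousOn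
    (hU1.continuous_fderiv one_ne_zero).continuousOn
  have hmem : ∀ s x, avg f s x ∈ Metric.closedBall (0 : W) C := fun s x => by
    simpa using avg_bound hC s x
  have hD10 : 0 ≤ D1 := (norm_nonneg _).trans (hD1 _ (hmem 0 0))
  have cN : Continuous (fun p : ℝ × 𝔼 => avg f p.1 p.2) := avg_cont hf.continuous hC
  have cNkk : ∀ k, Continuous (fun p : ℝ × 𝔼 => avg (pd k (pd k f)) p.1 p.2) := fun k => by
    obtain ⟨D, hD⟩ := (hkks k).exists_bound_of_continuous (hkk k)
    exact avg_cont (hkk k) hD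
  have ikk : ∀ k, Integrable (pd k (pd k f)) := fun k =>
    (hkk k).integrable_of_hasCompactSupport (hkks k)
  set Q : ℝ → 𝔼 → ℝ := fun s x =>
    (s / (2 * π)) * fderiv ℝ U (avg f s x) (∑ k, avg (pd k (pd k f)) s x) with hQ
  have cQ : Continuous (Function.uncurry Q) := by
    have c1 : Continuous (fun p : ℝ × 𝔼 => fderiv ℝ U (avg f p.1 p.2)) :=
      (hU1.continuous_fderiv one_ne_zero).comp cN
    have c2 : Continuous (fun p : ℝ × 𝔼 => ∑ k, avg (pd k (pd k f)) p.1 p.2) :=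
      continuous_finsetSum _ fun k _ => cNkk k
    exact (by fun_prop : Continuous (fun p : ℝ × 𝔼 => p.1 / (2 * π))).mul (c1.clm_apply c2)
  have hder : ∀ s x, HasDerivAt (fun s => U (avg f s x)) (Q s x) s := by
    intro s x
    have h1 := avg_time' hf hs s x
    have h2 := ((hU1.differentiable one_ne_zero) (avg f s x)).hasFDerivAt
    have := h2.comp_hasDerivAt s h1
    simpa [hQ, Function.comp_def] using this
  have ftc : ∀ x, ∫ s in (0:ℝ)..T, Q s x = U (avg f T x) - U (f x) := by
    intro x
    rw [intervalIntegral.integral_eq_sub_of_hasDerivAt (f := fun s => U (avg f s x))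
      (fun s _ => hder s x)
      ((cQ.comp (Continuous.prodMk_left x)).intervalIntegrable _ _), avg_zero]
  set L : ℝ := ∑ k : Fin d, ∫ x, ‖pd k (pd k f) x‖ with hL
  have hL0 : 0 ≤ L := Finset.sum_nonneg fun k _ => integral_nonneg fun x => norm_nonneg _
  have hQb : ∀ s x, ‖Q s x‖ ≤ |s / (2 * π)| * D1 * ∑ k, ‖avg (pd k (pd k f)) s x‖ := by
    intro s x
    simp only [hQ, norm_mul, norm_eq_abs (s / (2 * π)), mul_assoc]
    refine mul_le_mul_of_nonneg_left ?_ (abs_nonneg _)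
    refine (ContinuousLinearMap.le_opNorm _ _).trans ?_
    exact mul_le_mul (hD1 _ (hmem s x)) (norm_sum_le _ _) (norm_nonneg _) hD10
  have isum : ∀ s, Integrable (fun x => ∑ k, ‖avg (pd k (pd k f)) s x‖) := fun s =>
    integrable_finsetSum _ fun k _ => (avg_integrable (ikk k) (hkk k) s).norm
  have iQ : ∀ s, Integrable (Q s) := fun s =>
    ((isum s).const_mul (|s / (2 * π)| * D1)).mono'
      (cQ.comp (Continuous.prodMk_right s)).aestronglyMeasurable
      (Eventually.of_forall fun x => hQb s x)
  have hQL : ∀ s, ∫ x, ‖Q s x‖ ≤ |s / (2 * π)| * D1 * L := by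
    intro s
    calc ∫ x, ‖Q s x‖ ≤ ∫ x, |s / (2 * π)| * D1 * ∑ k, ‖avg (pd k (pd k f)) s x‖ :=
          integral_mono (iQ s).norm ((isum s).const_mul _) (hQb s)
      _ = |s / (2 * π)| * D1 * ∑ k, ∫ x, ‖avg (pd k (pd k f)) s x‖ := by
          rw [integral_const_mul, integral_finsetSum _
            fun k _ => (avg_integrable (ikk k) (hkk k) s).norm]
      _ ≤ _ := by
          refine mul_le_mul_of_nonneg_left ?_ (by positivity)
          exact Finset.sum_le_sum fun k _ => avg_L1 (ikk k) (hkk k) s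
  have hint : Integrable (Function.uncurry Q) ((volume.restrict (Set.uIoc 0 T)).prod volume) := by
    rw [integrable_prod_iff cQ.aestronglyMeasurable]
    refine ⟨Eventually.of_forall fun s => iQ s, ?_⟩
    have hm : AEStronglyMeasurable (fun s => ∫ x, ‖Function.uncurry Q (s, x)‖)
        (volume.restrict (Set.uIoc 0 T)) :=
      (cQ.norm.aestronglyMeasurable (μ := (volume.restrict (Set.uIoc 0 T)).prod volume)).integral_prod_right'
    have hb : Continuous (fun s : ℝ => |s / (2 * π)| * D1 * L) := by fun_prop
    have hbi := (hb.intervalIntegrable (μ := volume) 0 T)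
    rw [intervalIntegrable_iff] at hbi
    refine hbi.mono' hm (Eventually.of_forall fun s => ?_)
    rw [norm_of_nonneg (integral_nonneg fun x => norm_nonneg _)]
    exact hQL s
  have sw := intervalIntegral_integral_swap hint
  simp only [ftc] at sw
  rw [← sw]
  refine intervalIntegral.integral_nonneg hT fun s hs0 => ?_
  simp only [hQ, integral_const_mul]
  exact mul_nonneg (div_nonneg hs0.1 (by positivity)) (heat_mono hf hs hU H s)

theorem heat_main (hd : 1 ≤ d) {f : 𝔼 → W} (hf : ContDiff ℝ 2 f) (hs : HasCompactSupport f)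
    {U : W → ℝ} (hU : ContDiff ℝ 2 U) (hU0 : fderiv ℝ U 0 = 0)
    (H : ∀ s x, ∑ k, fderiv ℝ (fderiv ℝ U) (avg f s x) (avg (pd k f) s x) (avg (pd k f) s x) ≤ 0) :
    ∫ x, (U (f x) - U 0) ≤ 0 := by
  have hU1 : ContDiff ℝ 1 U := hU.of_le (by norm_num)
  obtain ⟨C, hC⟩ := hs.exists_bound_of_continuous hf.continuous
  have hcf := hf.continuous
  have hif : Integrable f := hcf.integrable_of_hasCompactSupport hs
  have hcp := isCompact_closedBall (0 : W) C
  obtain ⟨D1, hD1⟩ := hcp.exists_bound_of_continuousOn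
    (hU1.continuous_fderiv one_ne_zero).continuousOn
  have hlip : ∀ {r D : ℝ}, (∀ w ∈ Metric.closedBall (0 : W) r, ‖fderiv ℝ U w‖ ≤ D) →
      ∀ w ∈ Metric.closedBall (0 : W) r, ‖U w - U 0‖ ≤ D * ‖w‖ := by
    intro r D h w hw
    have hr : 0 ≤ r := (norm_nonneg w).trans (by simpa using hw)
    have := (convex_closedBall (0:W) r).norm_image_sub_le_of_norm_fderiv_le (𝕜 := ℝ) (f := U)
      (fun x _ => (hU1.differentiable one_ne_zero) x) h (Metric.mem_closedBall_self hr) hw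
    simpa using this
  have hmem : ∀ s x, avg f s x ∈ Metric.closedBall (0 : W) C := fun s x => by
    simpa using avg_bound hC s x
  have iU : ∀ s, Integrable (fun x => U (avg f s x) - U 0) := by
    intro s
    refine ((avg_integrable hif hcf s).norm.const_mul D1).mono' ?_
      (Eventually.of_forall fun x => hlip hD1 _ (hmem s x))
    exact ((hU.continuous.comp ((avg_cont hcf hC).comp (Continuous.prodMk_right s))).sub
      continuous_const).aestronglyMeasurable
  have iU0 : Integrable (fun x => U (f x) - U 0) := by
    simpa [avg_zero] using iU 0
  refine le_of_forall_pos_le_add fun ε hε => ?_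
  rw [zero_add]
  set L := ∫ x, ‖f x‖ with hL
  have hL0 : 0 ≤ L := integral_nonneg fun x => norm_nonneg _
  obtain ⟨η, hη, hη2⟩ : ∃ η > 0, ∀ w ∈ Metric.closedBall (0 : W) η, ‖fderiv ℝ U w‖ ≤ ε / (L + 1) := by
    have hc := (hU1.continuous_fderiv one_ne_zero).continuousAt (x := (0:W))
    obtain ⟨η, hη, h⟩ := Metric.continuousAt_iff.1 hc (ε / (L + 1)) (by positivity)
    refine ⟨η / 2, by positivity, fun w hw => ?_⟩
    have := h (x := w) (by
      have : dist w 0 ≤ η / 2 := hw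
      linarith)
    rw [hU0, dist_zero_right] at this
    exact this.le
  obtain ⟨T, hT0, hT⟩ : ∃ T : ℝ, 0 < T ∧ (T ^ Module.finrank ℝ 𝔼)⁻¹ * L ≤ η := by
    refine ⟨max 1 (L / η), by positivity, ?_⟩
    have h1 : (1:ℝ) ≤ max 1 (L / η) := le_max_left _ _
    have h2 : max 1 (L / η) ≤ (max 1 (L / η)) ^ Module.finrank ℝ 𝔼 := by
      apply le_self_pow₀ h1
      rw [finrank_euclideanSpace_fin]
      omega
    rw [inv_mul_le_iff₀ (by positivity)]
    have h3 : L ≤ max 1 (L / η) * η := by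
      rw [← div_le_iff₀ hη]
      exact le_max_right _ _
    nlinarith
  have h1 := heat_cmp hf hs hU H hT0.le
  have h2 : ∫ x, (U (avg f T x) - U 0) ≤ ε := by
    calc ∫ x, (U (avg f T x) - U 0) ≤ ∫ x, ε / (L + 1) * ‖avg f T x‖ := by
          refine integral_mono (iU T) ((avg_integrable hif hcf T).norm.const_mul _) fun x => ?_
          refine (le_abs_self _).trans (hlip hη2 _ ?_)
          simpa using (avg_decay hif hT0 x).trans hT
      _ ≤ ε / (L + 1) * L := by
          rw [integral_const_mul]
          exact mul_le_mul_of_nonneg_left (avg_L1 hif hcf T) (by positivity)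
      _ ≤ ε := by
          rw [div_mul_eq_mul_div, div_le_iff₀ (by positivity)]
          nlinarith
  have h3 : ∫ x, (U (avg f T x) - U (f x)) =
      (∫ x, (U (avg f T x) - U 0)) - ∫ x, (U (f x) - U 0) := by
    rw [← integral_sub (iU T) iU0]
    congr 1; ext x; ring
  linarith

end heat3
end

noncomputable section
set_option linter.unusedSectionVars false
section korn
open scoped Topology

variable {d : ℕ}
local notation "𝔼" => EuclideanSpace ℝ (Fin d)
local notation "𝕎" => EuclideanSpace ℝ (Fin d × Fin d)

/-- The matrix of a linear map, as a Euclidean vector. -/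
def opW : (EuclideanSpace ℝ (Fin d) →L[ℝ] EuclideanSpace ℝ (Fin d)) →L[ℝ]
    EuclideanSpace ℝ (Fin d × Fin d) :=
  LinearMap.toContinuousLinearMap
    { toFun := fun A => WithLp.toLp 2 fun p => A (EuclideanSpace.single p.2 1) p.1
      map_add' := fun A B => by ext p; simp
      map_smul' := fun c A => by ext p; simp }

lemma opW_apply (A : 𝔼 →L[ℝ] 𝔼) (p : Fin d × Fin d) :
    opW A p = A (EuclideanSpace.single p.2 1) p.1 := rfl

/-- Scaled symmetrization. -/
def symW (L : ℝ) : EuclideanSpace ℝ (Fin d × Fin d) →L[ℝ] EuclideanSpace ℝ (Fin d × Fin d) :=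
  LinearMap.toContinuousLinearMap
    { toFun := fun w => WithLp.toLp 2 fun p => L * ((1 / 2) * (w p + w (p.2, p.1)))
      map_add' := fun A B => by ext p; simp; ring
      map_smul' := fun c A => by ext p; simp; ring }

lemma symW_apply (L : ℝ) (w : 𝕎) (p : Fin d × Fin d) :
    symW L w p = L * ((1 / 2) * (w p + w (p.2, p.1))) := rfl

lemma symW_smul (L : ℝ) (w : 𝕎) : symW L w = L • symW 1 w := by
  ext p; simp [symW_apply]

lemma norm_opW (u : 𝔼 → 𝔼) (x : 𝔼) : ‖opW (fderiv ℝ u x)‖ = fnorm (jac u x) := by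
  rw [EuclideanSpace.norm_eq, fnorm, minner, Fintype.sum_prod_type]
  congr 1
  refine Finset.sum_congr rfl fun i _ => Finset.sum_congr rfl fun j _ => ?_
  rw [opW_apply, norm_eq_abs, sq_abs, sq]
  rfl

lemma norm_symW (u : 𝔼 → 𝔼) (x : 𝔼) : ‖symW 1 (opW (fderiv ℝ u x))‖ =
    fnorm ((1 / 2 : ℝ) • (jac u x + (jac u x).transpose)) := by
  rw [EuclideanSpace.norm_eq, fnorm, minner, Fintype.sum_prod_type]
  congr 1
  refine Finset.sum_congr rfl fun i _ => Finset.sum_congr rfl fun j _ => ?_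
  rw [symW_apply, norm_eq_abs, sq_abs, sq, one_mul]
  rfl

lemma sym_coercive (L : ℝ) (a : Fin d → 𝕎) (ha : ∀ k i j, a k (i, j) = a j (i, k)) :
    L ^ 2 * ∑ k, ‖a k‖ ^ 2 ≤ 9 * ∑ k, ‖symW L (a k)‖ ^ 2 := by
  have h1 : ∑ k, ‖a k‖ ^ 2 = ∑ k, ∑ i, ∑ j, (a k (i, j)) ^ 2 := by
    refine Finset.sum_congr rfl fun k _ => ?_
    rw [EuclideanSpace.norm_sq_eq, Fintype.sum_prod_type]
    simp
  set e : Fin d → Fin d → Fin d → ℝ := fun k i j => symW L (a k) (i, j) with he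
  have h2 : ∑ k, ‖symW L (a k)‖ ^ 2 = ∑ k, ∑ i, ∑ j, e k i j ^ 2 := by
    refine Finset.sum_congr rfl fun k _ => ?_
    rw [EuclideanSpace.norm_sq_eq, Fintype.sum_prod_type]
    simp [he]
  have h3 : ∀ k i j, L ^ 2 * (a k (i, j)) ^ 2 ≤
      3 * (e k i j ^ 2 + e j i k ^ 2 + e i j k ^ 2) := by
    intro k i j
    have : L * a k (i, j) = e k i j + e j i k - e i j k := by
      simp only [he, symW_apply]
      rw [ha j i k, ha i j k, ha j k i]
      ring
    rw [← mul_pow, this]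
    nlinarith [sq_nonneg (e k i j - e j i k), sq_nonneg (e k i j + e i j k),
      sq_nonneg (e j i k + e i j k)]
  have s1 : ∑ k, ∑ i, ∑ j, e j i k ^ 2 = ∑ k, ∑ i, ∑ j, e k i j ^ 2 := by
    rw [Finset.sum_comm]
    conv_rhs => rw [Finset.sum_comm]
    exact Finset.sum_congr rfl fun i _ => Finset.sum_comm
  have s2 : ∑ k, ∑ i, ∑ j, e i j k ^ 2 = ∑ k, ∑ i, ∑ j, e k i j ^ 2 := by
    rw [Finset.sum_comm]
    exact Finset.sum_congr rfl fun i _ => Finset.sum_comm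
  rw [h1, h2]
  calc L ^ 2 * ∑ k, ∑ i, ∑ j, (a k (i, j)) ^ 2
      = ∑ k, ∑ i, ∑ j, L ^ 2 * (a k (i, j)) ^ 2 := by simp only [Finset.mul_sum]
    _ ≤ ∑ k, ∑ i, ∑ j, 3 * (e k i j ^ 2 + e j i k ^ 2 + e i j k ^ 2) :=
        Finset.sum_le_sum fun k _ => Finset.sum_le_sum fun i _ => Finset.sum_le_sum fun j _ => h3 k i j
    _ = 3 * (∑ k, ∑ i, ∑ j, e k i j ^ 2 + ∑ k, ∑ i, ∑ j, e j i k ^ 2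
          + ∑ k, ∑ i, ∑ j, e i j k ^ 2) := by
        simp only [← Finset.mul_sum, Finset.sum_add_distrib]
    _ = _ := by rw [s1, s2]; ring

variable {φ φ' φ'' : ℝ → ℝ} {G : ℝ}

lemma bell_major (hN : IsNFunction φ φ') (hG : GoodPhi φ φ' φ'' G) {K r ρ : ℝ} (hK : 1 ≤ K)
    (hr : 0 < r) (hρ : 0 < ρ) :
    φ ρ ≤ 4 * ((ρ - K * r) * gz φ (r + ρ)) + (4 * K + 1) * (2 * K + 1) ^ (1 + G) * φ r := by
  have hs : 0 < r + ρ := by positivity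
  have hg := (gz_pos hN hG hs).le
  have hgs : gz φ (r + ρ) * (r + ρ) = φ (r + ρ) := by
    unfold gz; field_simp
  have hm : ∀ {a b : ℝ}, 0 ≤ a → a ≤ b → φ a ≤ φ b := fun ha hab =>
    phi_mono hN hG ha (ha.trans hab) hab
  have hφr := phi_nonneg hN hG hr.le
  have hφρ := phi_nonneg hN hG hρ.le
  have hC : 0 ≤ (2 * K + 1) ^ (1 + G) := by positivity
  have hX := phi_scale hN hG (l := 2 * K + 1) (t := r) (by linarith) hr.le
  rcases le_total (2 * K * r) ρ with h | h
  · have h1 := hm hρ.le (show ρ ≤ r + ρ by linarith)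
    have h2 : r ≤ ρ := by nlinarith
    have h3 : φ (r + ρ) ≤ 4 * ((ρ - K * r) * gz φ (r + ρ)) := by
      rw [← hgs]
      nlinarith [mul_le_mul_of_nonneg_left (show r + ρ ≤ 4 * (ρ - K * r) by linarith) hg]
    have : 0 ≤ (4 * K + 1) * (2 * K + 1) ^ (1 + G) * φ r := by positivity
    linarith
  · have h1 : φ ρ ≤ φ ((2 * K + 1) * r) := hm hρ.le (by linarith)
    have h2 : φ (r + ρ) ≤ φ ((2 * K + 1) * r) := hm hs.le (by linarith)
    have h3 : -(K * φ (r + ρ)) ≤ (ρ - K * r) * gz φ (r + ρ) := by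
      rw [← hgs]
      have : 0 ≤ (ρ + K * ρ) * gz φ (r + ρ) := by positivity
      nlinarith
    nlinarith

lemma bellU_even (hG : GoodPhi φ φ' φ'' G) (K : ℝ) {δ : ℝ} (hδ : 0 < δ) (S : 𝕎 →L[ℝ] 𝕎) :
    fderiv ℝ (bellU φ K δ S) 0 = 0 := by
  have h : (fun w => bellU φ K δ S (-w)) = bellU φ K δ S := by
    ext w; simp [bellU, rootN]
  have h1 := (((bellU_contDiff hG K hδ S).differentiable two_ne_zero) 0).hasFDerivAt
  have h2 := (((bellU_contDiff hG K hδ S).differentiable two_ne_zero) (-0)).hasFDerivAt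
  have h3 := h2.comp (0 : 𝕎) (hasFDerivAt_id (𝕜 := ℝ) (0 : 𝕎)).neg
  have h4 : (bellU φ K δ S ∘ fun w => -id w) = bellU φ K δ S := h
  rw [neg_zero] at h3
  have h5 := h1.unique (h4 ▸ h3)
  ext w
  have := congrArg (fun A => A w) h5
  simp at this ⊢
  linarith

lemma hess_symm {v : 𝔼 → 𝔼} (hv : ContDiff ℝ 3 v) (k i j : Fin d) (y : 𝔼) :
    pd k (fun x => opW (fderiv ℝ v x)) y (i, j) = pd j (fun x => opW (fderiv ℝ v x)) y (i, k) := by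
  have h1 : ContDiff ℝ 2 (fderiv ℝ v) := hv.fderiv_right (by norm_num)
  have h2 := ((h1.differentiable (by norm_num)) y).hasFDerivAt
  have h3 : fderiv ℝ (fun x => opW (fderiv ℝ v x)) y = opW.comp (fderiv ℝ (fderiv ℝ v) y) :=
    (opW.hasFDerivAt.comp y h2).fderiv
  unfold pd
  rw [h3]
  simp only [ContinuousLinearMap.comp_apply, opW_apply]
  have h4 : IsSymmSndFDerivAt ℝ v y :=
    (hv.contDiffAt).isSymmSndFDerivAt (by simp; norm_num)
  rw [h4 _ _]

lemma avg_symm {v : 𝔼 → 𝔼} (hv : ContDiff ℝ 3 v) (hs : HasCompactSupport v) (s : ℝ) (x : 𝔼)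
    (k i j : Fin d) :
    avg (pd k (fun x => opW (fderiv ℝ v x))) s x (i, j) =
      avg (pd j (fun x => opW (fderiv ℝ v x))) s x (i, k) := by
  have h1 : ContDiff ℝ 2 (fderiv ℝ v) := hv.fderiv_right (by norm_num)
  have hJ : ContDiff ℝ 2 (fun x => opW (fderiv ℝ v x)) := opW.contDiff.comp h1
  have hJs : HasCompactSupport (fun x => opW (fderiv ℝ v x)) :=
    (hs.fderiv ℝ).comp_left (g := opW) (map_zero _)
  have key : ∀ (k : Fin d) (p : Fin d × Fin d), avg (pd k (fun x => opW (fderiv ℝ v x))) s x p =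
      ∫ z : 𝔼, gw z * pd k (fun x => opW (fderiv ℝ v x)) (x + s • z) p := by
    intro k p
    have hc := (pd_contDiff (n := 1) k hJ).continuous
    obtain ⟨D, hD⟩ := (pd_supp k hJs).exists_bound_of_continuous hc
    have := ContinuousLinearMap.integral_comp_comm (EuclideanSpace.proj (𝕜 := ℝ) p : 𝕎 →L[ℝ] ℝ)
      (avg_integrand hc hD s x)
    simpa [avg] using this.symm
  rw [key, key]
  congr 1; ext z
  rw [hess_symm hv k i j]

/-- `φ` extended evenly. -/
lemma phi_abs_cont (hN : IsNFunction φ φ') (hG : GoodPhi φ φ' φ'' G) :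
    Continuous (fun t => φ |t|) :=
  (phi_cont hN hG).comp_continuous continuous_abs fun t => abs_nonneg t

lemma korn_delta (hd : 1 ≤ d) (hN : IsNFunction φ φ') (hG : GoodPhi φ φ' φ'' G) {M K L : ℝ}
    (hM : M = (G + 3) ^ 2) (hK : K = 2 * G * M)
    (hL : 36 * G * (4 * M + 36 * G * M ^ 2) ≤ L ^ 2) {δ : ℝ} (hδ : 0 < δ)
    {v : 𝔼 → 𝔼} (hv : ContDiff ℝ 3 v) (hs : HasCompactSupport v) :
    ∫ x, (bellU φ K δ (symW L) (opW (fderiv ℝ v x)) - bellU φ K δ (symW L) (0 : 𝕎)) ≤ 0 := by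
  have h1 : ContDiff ℝ 2 (fderiv ℝ v) := hv.fderiv_right (by norm_num)
  have hJ : ContDiff ℝ 2 (fun x => opW (fderiv ℝ v x)) := opW.contDiff.comp h1
  have hJs : HasCompactSupport (fun x => opW (fderiv ℝ v x)) :=
    (hs.fderiv ℝ).comp_left (g := opW) (map_zero _)
  have hG1 := hG.1
  refine heat_main hd hJ hJs (bellU_contDiff hG K hδ _) (bellU_even hG _ hδ _) fun s x => ?_
  set w := avg (fun x => opW (fderiv ℝ v x)) s x
  set a := fun k => avg (pd k (fun x => opW (fderiv ℝ v x))) s x with ha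
  have hco := sym_coercive L a (fun k i j => avg_symm hv hs s x k i j)
  set st := rootN δ (symW L w) + rootN δ w with hst
  have hst0 : 0 < st := add_pos (rootN_pos hδ _) (rootN_pos hδ _)
  have hM0 : 0 ≤ M := by rw [hM]; positivity
  have hK0 : 0 ≤ K := by rw [hK]; positivity
  calc ∑ k, fderiv ℝ (fderiv ℝ (bellU φ K δ (symW L))) w (a k) (a k)
      ≤ ∑ k, gz φ st / st * K * (-(‖symW L (a k)‖ ^ 2 / (4 * G)) +
          (4 * M + 36 * G * M ^ 2) * ‖a k‖ ^ 2) :=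
        Finset.sum_le_sum fun k _ => bellU_second hN hG hM hK hδ (symW L) w (a k)
    _ = gz φ st / st * K * (-((∑ k, ‖symW L (a k)‖ ^ 2) / (4 * G)) +
          (4 * M + 36 * G * M ^ 2) * ∑ k, ‖a k‖ ^ 2) := by
        rw [← Finset.mul_sum, Finset.sum_add_distrib, Finset.sum_neg_distrib, ← Finset.sum_div,
          ← Finset.mul_sum]
    _ ≤ 0 := by
        refine mul_nonpos_of_nonneg_of_nonpos
          (mul_nonneg (div_nonneg (gz_pos hN hG hst0).le hst0.le) hK0) ?_
        have hA : 0 ≤ ∑ k, ‖a k‖ ^ 2 := Finset.sum_nonneg fun k _ => sq_nonneg _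
        have := mul_le_mul_of_nonneg_right hL hA
        rw [neg_add_nonpos_iff, le_div_iff₀ (by positivity)]
        nlinarith

theorem korn_smooth (hd : 1 ≤ d) (G : ℝ) (hG1 : 1 ≤ G) : ∃ C : ℝ, 0 ≤ C ∧
    ∀ φ φ' φ'' : ℝ → ℝ, IsNFunction φ φ' → GoodPhi φ φ' φ'' G →
    ∀ v : 𝔼 → 𝔼, ContDiff ℝ 3 v → HasCompactSupport v →
    ∫ x, φ ‖opW (fderiv ℝ v x)‖ ≤ C * ∫ x, φ ‖symW 1 (opW (fderiv ℝ v x))‖ := by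
  set M : ℝ := (G + 3) ^ 2 with hM
  set K : ℝ := 2 * G * M with hK
  set L : ℝ := 1 + 36 * G * (4 * M + 36 * G * M ^ 2) with hL
  have hM1 : 1 ≤ M := by rw [hM]; nlinarith
  have hK1 : 1 ≤ K := by rw [hK]; nlinarith
  have hp : 0 ≤ 36 * G * (4 * M + 36 * G * M ^ 2) := by positivity
  have hL1 : 1 ≤ L := by linarith
  have hL2 : 36 * G * (4 * M + 36 * G * M ^ 2) ≤ L ^ 2 := by rw [hL]; nlinarith
  set C0 : ℝ := (4 * K + 1) * (2 * K + 1) ^ (1 + G) with hC0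
  have hC00 : 0 ≤ C0 := by positivity
  refine ⟨C0 * L ^ (1 + G), by positivity, fun φ φ' φ'' hN hG v hv hs => ?_⟩
  set J : 𝔼 → 𝕎 := fun x => opW (fderiv ℝ v x) with hJd
  have h1 : ContDiff ℝ 2 (fderiv ℝ v) := hv.fderiv_right (by norm_num)
  have hJ : ContDiff ℝ 2 J := opW.contDiff.comp h1
  have hJs : HasCompactSupport J := (hs.fderiv ℝ).comp_left (g := opW) (map_zero _)
  have hJc := hJ.continuous
  set B : Set 𝔼 := tsupport J with hB
  have hBc : IsCompact B := hJs
  have hBm : MeasurableSet B := hBc.measurableSet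
  have hJ0 : ∀ x, x ∉ B → J x = 0 := fun x hx => image_eq_zero_of_notMem_tsupport hx
  have hφ0 := phi_zero hN
  have hφa := phi_abs_cont hN hG
  have cont : ∀ {g : 𝔼 → ℝ}, Continuous g → (∀ x, 0 ≤ g x) → Continuous (fun x => φ (g x)) := by
    intro g hg h0
    have := hφa.comp hg
    refine this.congr fun x => ?_
    simp [abs_of_nonneg (h0 x)]
  have contR : ∀ (δ : ℝ) (S : 𝕎 →L[ℝ] 𝕎), Continuous (fun x => rootN δ (S (J x))) := by
    intro δ S; unfold rootN; fun_prop
  have contR' : ∀ (δ : ℝ), Continuous (fun x => rootN δ (J x)) := by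
    intro δ; unfold rootN; fun_prop
  -- inequality for each δ
  have step : ∀ δ : ℝ, 0 < δ → ∫ x in B, φ ‖J x‖ ≤ C0 * ∫ x in B, φ |rootN δ (symW L (J x))| := by
    intro δ hδ
    have hk := korn_delta hd hN hG hM hK hL2 hδ hv hs
    have hk2 : ∫ x in B, (bellU φ K δ (symW L) (J x) - bellU φ K δ (symW L) (0 : 𝕎)) ≤ 0 := by
      rwa [setIntegral_eq_integral_of_forall_compl_eq_zero]
      intro x hx
      rw [hJ0 x hx, sub_self]
    have hU0 : bellU φ K δ (symW L : 𝕎 →L[ℝ] 𝕎) 0 ≤ 0 := by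
      unfold bellU
      have h0 : rootN δ (0 : 𝕎) = δ := by simp [rootN, sqrt_sq hδ.le]
      rw [map_zero, h0]
      refine mul_nonpos_of_nonpos_of_nonneg ?_ (gz_pos hN hG (by positivity)).le
      nlinarith
    have cU : Continuous (fun x => bellU φ K δ (symW L) (J x) - bellU φ K δ (symW L) (0 : 𝕎)) :=
      ((bellU_contDiff hG K hδ _).continuous.comp hJc).sub continuous_const
    have iU := (cU.continuousOn (s := B)).integrableOn_compact (μ := volume) hBc
    have cR : Continuous (fun x => φ |rootN δ (symW L (J x))|) := hφa.comp (contR δ (symW L))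
    have iR := (cR.continuousOn (s := B)).integrableOn_compact (μ := volume) hBc
    have iJ := ((cont hJc.norm fun x => norm_nonneg _).continuousOn (s := B)).integrableOn_compact
      (μ := volume) hBc
    have hle : ∫ x in B, φ ‖J x‖ ≤ ∫ x in B, (4 * (bellU φ K δ (symW L) (J x) -
        bellU φ K δ (symW L) (0 : 𝕎)) + C0 * φ |rootN δ (symW L (J x))|) := by
      refine integral_mono iJ ((iU.const_mul 4).add (iR.const_mul C0)) fun x => ?_
      have hb := bell_major hN hG hK1 (rootN_pos hδ (symW L (J x))) (rootN_pos hδ (J x))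
      have hn : ‖J x‖ ≤ rootN δ (J x) := by
        unfold rootN
        apply le_sqrt_of_sq_le
        nlinarith [sq_nonneg δ]
      have h3 : φ ‖J x‖ ≤ φ (rootN δ (J x)) :=
        phi_mono hN hG (norm_nonneg _) (rootN_pos hδ (J x)).le hn
      simp only
      rw [abs_of_pos (rootN_pos hδ _)]
      unfold bellU at hU0 ⊢
      linarith
    rw [integral_add (iU.const_mul 4) (iR.const_mul C0), integral_const_mul,
      integral_const_mul] at hle
    linarith
  -- limit
  have lim : Tendsto (fun δ : ℝ => C0 * ∫ x in B, φ |rootN δ (symW L (J x))|) (𝓝[>] 0)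
      (𝓝 (C0 * ∫ x in B, φ |rootN 0 (symW L (J x))|)) := by
    have c : Continuous (fun δ : ℝ => ∫ x in B, φ |rootN δ (symW L (J x))|) := by
      refine continuous_parametric_integral_of_continuous (μ := volume) ?_ hBc
      refine hφa.comp (?_ : Continuous fun p : ℝ × 𝔼 => rootN p.1 (symW L (J p.2)))
      unfold rootN
      fun_prop
    exact ((c.tendsto 0).const_mul C0).mono_left nhdsWithin_le_nhds
  have fin : ∫ x in B, φ ‖J x‖ ≤ C0 * ∫ x in B, φ |rootN 0 (symW L (J x))| :=
    ge_of_tendsto lim (eventually_nhdsWithin_of_forall fun δ hδ => step δ hδ)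
  have e0 : ∀ x, |rootN 0 (symW L (J x))| = L * ‖symW 1 (J x)‖ := by
    intro x
    unfold rootN
    rw [symW_smul, norm_smul, norm_of_nonneg (by linarith), zero_pow two_ne_zero, zero_add,
      sqrt_sq (by positivity), abs_of_nonneg (by positivity)]
  have cS : Continuous (fun x => φ ‖symW 1 (J x)‖) :=
    cont ((symW 1).continuous.comp hJc).norm fun x => norm_nonneg _
  have iS := (cS.continuousOn (s := B)).integrableOn_compact (μ := volume) hBc
  have cS2 : Continuous (fun x => φ (L * ‖symW 1 (J x)‖)) :=
    cont (continuous_const.mul ((symW 1).continuous.comp hJc).norm) fun x => by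
      have := norm_nonneg (symW 1 (J x)); positivity
  have iS2 := (cS2.continuousOn (s := B)).integrableOn_compact (μ := volume) hBc
  have hle2 : ∫ x in B, φ |rootN 0 (symW L (J x))| ≤ L ^ (1 + G) * ∫ x in B, φ ‖symW 1 (J x)‖ := by
    simp only [e0]
    rw [← integral_const_mul]
    exact integral_mono iS2 (iS.const_mul _) fun x => phi_scale hN hG hL1 (norm_nonneg _)
  have z1 : ∫ x in B, φ ‖J x‖ = ∫ x, φ ‖J x‖ :=
    setIntegral_eq_integral_of_forall_compl_eq_zero fun x hx => by rw [hJ0 x hx, norm_zero, hφ0]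
  have z2 : ∫ x in B, φ ‖symW 1 (J x)‖ = ∫ x, φ ‖symW 1 (J x)‖ :=
    setIntegral_eq_integral_of_forall_compl_eq_zero fun x hx => by
      rw [hJ0 x hx, map_zero, norm_zero, hφ0]
  rw [← z1, ← z2]
  calc _ ≤ _ := fin
    _ ≤ C0 * (L ^ (1 + G) * ∫ x in B, φ ‖symW 1 (J x)‖) := mul_le_mul_of_nonneg_left hle2 hC00
    _ = _ := by ring

end korn
end

noncomputable section
set_option linter.unusedSectionVars false
section kornlip
open scoped Topology Convolution

variable {d : ℕ}
local notation "𝔼" => EuclideanSpace ℝ (Fin d)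
local notation "𝕎" => EuclideanSpace ℝ (Fin d × Fin d)
variable {φ φ' φ'' : ℝ → ℝ} {G : ℝ}

lemma lip_fderiv_int {v : 𝔼 → 𝔼} {K : NNReal} (hv : LipschitzWith K v) :
    LocallyIntegrable (fun x => fderiv ℝ v x) volume := by
  refine LocallyIntegrable.mono (locallyIntegrable_const (K : ℝ))
    (measurable_fderiv ℝ v).aestronglyMeasurable ?_
  refine Eventually.of_forall fun x => ?_
  exact (norm_fderiv_le_of_lipschitz ℝ hv).trans (le_abs_self _)

lemma moll_fderiv {v : 𝔼 → 𝔼} {K : NNReal} (hv : LipschitzWith K v)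
    (b : ContDiffBump (0 : 𝔼)) (x : 𝔼) :
    HasFDerivAt (b.normed volume ⋆[ContinuousLinearMap.lsmul ℝ ℝ, volume] v)
      ((b.normed volume ⋆[ContinuousLinearMap.lsmul ℝ ℝ, volume] (fun y => fderiv ℝ v y)) x) x := by
  have hbc : Continuous (b.normed (volume : Measure 𝔼)) := b.continuous_normed
  have hbs : HasCompactSupport (b.normed (volume : Measure 𝔼)) := b.hasCompactSupport_normed
  have hfm : Measurable (fun y => fderiv ℝ v y) := measurable_fderiv ℝ v
  refine (hasFDerivAt_integral_of_dominated_loc_of_lip (μ := volume)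
    (F := fun x t => b.normed volume t • v (x - t))
    (F' := fun t => b.normed volume t • fderiv ℝ v (x - t))
    (bound := fun t => b.normed volume t * K) (s := univ) (x₀ := x) univ_mem ?_ ?_ ?_ ?_ ?_ ?_).2
  · refine Eventually.of_forall fun y => Continuous.aestronglyMeasurable ?_
    exact hbc.smul (hv.continuous.comp (continuous_const.sub continuous_id))
  · refine Continuous.integrable_of_hasCompactSupport
      (hbc.smul (hv.continuous.comp (continuous_const.sub continuous_id))) ?_
    exact hbs.smul_right
  · exact (hbc.measurable.smul (hfm.comp (measurable_const.sub measurable_id))).aestronglyMeasurable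
  · refine Eventually.of_forall fun t => ?_
    refine LipschitzOnWith.of_dist_le_mul fun y _ z _ => ?_
    rw [dist_eq_norm, ← smul_sub, norm_smul, Real.norm_of_nonneg (b.nonneg_normed t)]
    have h := hv.dist_le_mul (y - t) (z - t)
    rw [dist_eq_norm, dist_sub_right] at h
    have h0 := b.nonneg_normed (μ := (volume : Measure 𝔼)) t
    rw [Real.coe_nnabs, abs_of_nonneg (by positivity), mul_assoc]
    exact mul_le_mul_of_nonneg_left h h0
  · exact (hbc.mul continuous_const).integrable_of_hasCompactSupport hbs.mul_right
  · have h1 : ∀ᵐ y ∂(volume : Measure 𝔼), DifferentiableAt ℝ v y := hv.ae_differentiableAt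
    have h2 : ∀ᵐ t ∂(volume : Measure 𝔼), DifferentiableAt ℝ v (x - t) :=
      (Measure.measurePreserving_sub_left (volume : Measure 𝔼) x).quasiMeasurePreserving.ae h1
    filter_upwards [h2] with t ht
    have := (ht.hasFDerivAt.comp x ((hasFDerivAt_id x).sub_const t))
    have h3 := this.const_smul (b.normed volume t)
    rw [ContinuousLinearMap.comp_id] at h3
    exact h3

theorem korn_lip (hd : 1 ≤ d) (G : ℝ) (hG1 : 1 ≤ G) : ∃ C : ℝ, 0 ≤ C ∧
    ∀ φ φ' φ'' : ℝ → ℝ, IsNFunction φ φ' → GoodPhi φ φ' φ'' G →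
    ∀ (v : 𝔼 → 𝔼) (K : NNReal), LipschitzWith K v → HasCompactSupport v →
      ∫ x, φ ‖opW (fderiv ℝ v x)‖ ≤ C * ∫ x, φ ‖symW 1 (opW (fderiv ℝ v x))‖ := by
  obtain ⟨C, hC, h⟩ := korn_smooth hd G hG1
  refine ⟨C, hC, fun φ φ' φ'' hN hG v K hv hs => ?_⟩
  obtain ⟨R, hR⟩ := hs.isCompact.isBounded.subset_closedBall (0 : 𝔼)
  let b : ℕ → ContDiffBump (0 : 𝔼) := fun n =>
    { rIn := 1 / (2 * ((n : ℝ) + 1)), rOut := 1 / ((n : ℝ) + 1), rIn_pos := by positivity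
      rIn_lt_rOut := by
        have : (0:ℝ) < n + 1 := by positivity
        apply one_div_lt_one_div_of_lt this; linarith }
  have hb0 : Tendsto (fun n => (b n).rOut) atTop (𝓝 0) := tendsto_one_div_add_atTop_nhds_zero_nat
  have hb1 : ∀ n, (b n).rOut ≤ 1 := fun n => by
    show 1 / ((n : ℝ) + 1) ≤ 1
    rw [div_le_one (by positivity)]; linarith [(Nat.cast_nonneg n : (0:ℝ) ≤ n)]
  have hb2 : ∀ n, (b n).rOut ≤ 2 * (b n).rIn := fun n => by
    show 1 / ((n : ℝ) + 1) ≤ 2 * (1 / (2 * ((n : ℝ) + 1)))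
    apply le_of_eq; field_simp
  set vn : ℕ → 𝔼 → 𝔼 := fun n =>
    ((b n).normed volume ⋆[ContinuousLinearMap.lsmul ℝ ℝ, volume] v) with hvn
  have hd1 : ∀ n x, fderiv ℝ (vn n) x = ((b n).normed volume
      ⋆[ContinuousLinearMap.lsmul ℝ ℝ, volume] (fun y => fderiv ℝ v y)) x :=
    fun n x => (moll_fderiv hv (b n) x).fderiv
  have hsm : ∀ n, ContDiff ℝ 3 (vn n) := fun n =>
    (b n).hasCompactSupport_normed.contDiff_convolution_left _ (b n).contDiff_normed
      hv.continuous.locallyIntegrable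
  have hcs : ∀ n, HasCompactSupport (vn n) := fun n =>
    HasCompactSupport.convolution _ (b n).hasCompactSupport_normed hs
  have hae : ∀ᵐ x ∂(volume : Measure 𝔼),
      Tendsto (fun n => fderiv ℝ (vn n) x) atTop (𝓝 (fderiv ℝ v x)) := by
    simp only [hd1]
    exact ContDiffBump.ae_convolution_tendsto_right_of_locallyIntegrable (K := 2) hb0
      (Eventually.of_forall hb2) (lip_fderiv_int hv)
  have hlipn : ∀ n, LipschitzWith K (vn n) := fun n => by
    refine LipschitzWith.of_dist_le_mul fun y z => ?_
    have hbc : Continuous ((b n).normed (volume : Measure 𝔼)) := (b n).continuous_normed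
    have hbs : HasCompactSupport ((b n).normed (volume : Measure 𝔼)) :=
      (b n).hasCompactSupport_normed
    have hi : ∀ y, Integrable (fun t => (b n).normed volume t • v (y - t)) volume := fun y =>
      Continuous.integrable_of_hasCompactSupport
        (hbc.smul (hv.continuous.comp (continuous_const.sub continuous_id))) hbs.smul_right
    rw [dist_eq_norm]
    show ‖(∫ t, (b n).normed volume t • v (y - t)) - ∫ t, (b n).normed volume t • v (z - t)‖ ≤ _
    rw [← integral_sub (hi y) (hi z)]
    have : ∫ t, (b n).normed volume t * (K * dist y z) = K * dist y z := by
      rw [integral_mul_const, (b n).integral_normed, one_mul]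
    rw [← this]
    refine norm_integral_le_of_norm_le ((hbc.mul
      continuous_const).integrable_of_hasCompactSupport hbs.mul_right)
      (Eventually.of_forall fun t => ?_)
    rw [← smul_sub, norm_smul, Real.norm_of_nonneg ((b n).nonneg_normed t)]
    have h := hv.dist_le_mul (y - t) (z - t)
    rw [dist_eq_norm, dist_sub_right] at h
    exact mul_le_mul_of_nonneg_left h ((b n).nonneg_normed t)
  have hsupp : ∀ n x, x ∉ Metric.closedBall (0 : 𝔼) (R + 1) → fderiv ℝ (vn n) x = 0 := by
    intro n x hx
    rw [hd1]
    refine integral_eq_zero_of_ae (Eventually.of_forall fun t => ?_)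
    show (b n).normed volume t • fderiv ℝ v (x - t) = 0
    by_cases ht : t ∈ Metric.ball (0 : 𝔼) (b n).rOut
    · have : x - t ∉ tsupport v := fun hh => by
        have h1 := hR hh
        rw [mem_closedBall_zero_iff] at h1 hx
        rw [mem_ball_zero_iff] at ht
        have h2 : ‖x‖ ≤ ‖x - t‖ + ‖t‖ := by simpa using norm_add_le (x - t) t
        linarith [hb1 n]
      have h3 : fderiv ℝ v (x - t) = 0 := by
        by_contra h4
        exact this (support_fderiv_subset ℝ h4)
      rw [h3]; refine ContinuousLinearMap.ext fun y => ?_; exact smul_zero ((b n).normed volume t)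
    · have : (b n).normed volume t = 0 := by
        by_contra h4
        rw [← (b n).support_normed_eq (μ := (volume : Measure 𝔼))] at ht
        exact ht h4
      rw [this]; refine ContinuousLinearMap.ext fun y => ?_; exact zero_smul ℝ (fderiv ℝ v (x - t) y)
  -- dominated convergence
  have key : ∀ T : (𝔼 →L[ℝ] 𝔼) →L[ℝ] 𝕎,
      Tendsto (fun n => ∫ x, φ ‖T (fderiv ℝ (vn n) x)‖) atTop
        (𝓝 (∫ x, φ ‖T (fderiv ℝ v x)‖)) := by
    intro T
    have hcp := phi_abs_cont hN hG
    have hcT : Continuous (fun A : 𝔼 →L[ℝ] 𝔼 => φ ‖T A‖) := by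
      have := hcp.comp (T.continuous.norm)
      refine this.congr fun A => ?_
      simp
    refine tendsto_integral_of_dominated_convergence
      (indicator (Metric.closedBall (0 : 𝔼) (R + 1)) fun _ => φ (‖T‖ * K)) ?_ ?_ ?_ ?_
    · intro n
      exact (hcT.measurable.comp (measurable_fderiv ℝ (vn n))).aestronglyMeasurable
    · rw [integrable_indicator_iff Metric.isClosed_closedBall.measurableSet]
      exact integrableOn_const (isCompact_closedBall _ _).measure_lt_top.ne
    · intro n
      refine Eventually.of_forall fun x => ?_
      by_cases hx : x ∈ Metric.closedBall (0 : 𝔼) (R + 1)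
      · rw [indicator_of_mem hx, Real.norm_of_nonneg (phi_nonneg hN hG (norm_nonneg _))]
        refine phi_mono hN hG (mem_Ici.2 (norm_nonneg _)) (mem_Ici.2 (by positivity)) ?_
        refine (T.le_opNorm _).trans ?_
        gcongr
        exact norm_fderiv_le_of_lipschitz ℝ (hlipn n)
      · rw [indicator_of_notMem hx, hsupp n x hx]
        simp [phi_zero hN]
    · filter_upwards [hae] with x hx
      exact (hcT.tendsto _).comp hx
  refine le_of_tendsto_of_tendsto' (key opW) ((key ((symW 1).comp opW)).const_mul C) fun n => ?_
  exact h φ φ' φ'' hN hG (vn n) (hsm n) (hcs n)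

end kornlip
end

noncomputable section
set_option linter.unusedSectionVars false
section kornsym
open scoped Topology

variable {d : ℕ}
local notation "𝔼" => EuclideanSpace ℝ (Fin d)
local notation "𝕎" => EuclideanSpace ℝ (Fin d × Fin d)

lemma inner_single_eq (w : 𝔼) (i : Fin d) : inner ℝ w (EuclideanSpace.single i (1:ℝ)) = w i := by
  rw [EuclideanSpace.inner_single_right]; simp

lemma symW_le_of_quad (A : 𝔼 →L[ℝ] 𝔼) {κ : ℝ} (hκ : 0 ≤ κ)
    (h : ∀ y : 𝔼, |inner ℝ (A y) y| ≤ κ * ‖y‖ ^ 2) :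
    ‖symW 1 (opW A)‖ ≤ 3 * d * κ := by
  have he : ∀ p : Fin d × Fin d, |symW 1 (opW A) p| ≤ 3 * κ := by
    rintro ⟨i, j⟩
    set a : 𝔼 := EuclideanSpace.single i (1:ℝ) with ha
    set b : 𝔼 := EuclideanSpace.single j (1:ℝ) with hb
    have hna : ‖a‖ = 1 := by simp [ha]
    have hnb : ‖b‖ = 1 := by simp [hb]
    have h1 : symW 1 (opW A) (i, j) = (1 / 2) * (inner ℝ (A b) a + inner ℝ (A a) b) := by
      rw [symW_apply, opW_apply, opW_apply, one_mul, ha, hb, inner_single_eq, inner_single_eq]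
    have h2 : inner ℝ (A (a + b)) (a + b) = inner ℝ (A a) a + inner ℝ (A b) b
        + (inner ℝ (A b) a + inner ℝ (A a) b) := by
      rw [map_add, inner_add_left, inner_add_right, inner_add_right]; ring
    have h3 := h (a + b)
    have h4 := h a
    have h5 := h b
    have h6 : ‖a + b‖ ^ 2 ≤ 4 := by
      have := norm_add_le a b
      rw [hna, hnb] at this
      nlinarith [norm_nonneg (a + b)]
    have h7 : κ * ‖a + b‖ ^ 2 ≤ κ * 4 := mul_le_mul_of_nonneg_left h6 hκ
    rw [hna] at h4
    rw [hnb] at h5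
    rw [h1]
    rw [abs_le] at *
    constructor <;> linarith [h3.1, h3.2, h4.1, h4.2, h5.1, h5.2]
  have h2 : ‖symW 1 (opW A)‖ ^ 2 ≤ (3 * d * κ) ^ 2 := by
    rw [EuclideanSpace.norm_sq_eq]
    calc ∑ p, ‖symW 1 (opW A) p‖ ^ 2 ≤ ∑ p : Fin d × Fin d, (3 * κ) ^ 2 := by
          refine Finset.sum_le_sum fun p _ => ?_
          exact pow_le_pow_left₀ (norm_nonneg _) (he p) 2
      _ = (3 * d * κ) ^ 2 := by simp; ring
  exact (abs_le_of_sq_le_sq' h2 (by positivity)).2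

lemma quad_le_symW (A : 𝔼 →L[ℝ] 𝔼) (y : 𝔼) :
    |inner ℝ (A y) y| ≤ d ^ 2 * ‖symW 1 (opW A)‖ * ‖y‖ ^ 2 := by
  have hA : ∀ i, A y i = ∑ j, y j * A (EuclideanSpace.single j 1) i := by
    intro i
    have hy : y = ∑ j, y j • (EuclideanSpace.single j (1:ℝ) : 𝔼) := by
      ext k
      simp [Pi.single_apply]
    conv_lhs => rw [hy]
    simp
  have h1 : inner ℝ (A y) y = ∑ i, ∑ j, opW A (i, j) * (y i * y j) := by
    rw [PiLp.inner_apply]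
    refine Finset.sum_congr rfl fun i _ => ?_
    rw [hA i]
    simp only [RCLike.inner_apply, conj_trivial, opW_apply]
    rw [Finset.mul_sum]
    refine Finset.sum_congr rfl fun j _ => by ring
  have h2 : inner ℝ (A y) y = ∑ i, ∑ j, symW 1 (opW A) (i, j) * (y i * y j) := by
    have h3 : inner ℝ (A y) y = ∑ i, ∑ j, opW A (j, i) * (y i * y j) := by
      rw [h1, Finset.sum_comm]
      refine Finset.sum_congr rfl fun i _ => Finset.sum_congr rfl fun j _ => by ring
    have h4 : inner ℝ (A y) y = (1 / 2) * (inner ℝ (A y) y + inner ℝ (A y) y) := by ring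
    rw [h4]
    nth_rewrite 1 [h1]
    rw [h3, ← Finset.sum_add_distrib, Finset.mul_sum]
    refine Finset.sum_congr rfl fun i _ => ?_
    rw [← Finset.sum_add_distrib, Finset.mul_sum]
    refine Finset.sum_congr rfl fun j _ => ?_
    rw [symW_apply]; ring
  rw [h2]
  refine (Finset.abs_sum_le_sum_abs _ _).trans ?_
  calc ∑ i, |∑ j, symW 1 (opW A) (i, j) * (y i * y j)|
      ≤ ∑ i : Fin d, ∑ j : Fin d, ‖symW 1 (opW A)‖ * ‖y‖ ^ 2 := by
        refine Finset.sum_le_sum fun i _ => (Finset.abs_sum_le_sum_abs _ _).trans ?_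
        refine Finset.sum_le_sum fun j _ => ?_
        rw [abs_mul, abs_mul, sq]
        have := PiLp.norm_apply_le (symW 1 (opW A)) (i, j)
        have hi := PiLp.norm_apply_le y i
        have hj := PiLp.norm_apply_le y j
        simp only [norm_eq_abs] at this hi hj
        gcongr
    _ = _ := by simp; ring

end kornsym

section extension
open scoped Topology
variable {d : ℕ}
local notation "𝔼" => EuclideanSpace ℝ (Fin d)

/-- Reflection-like map. -/
def Psi (c : ℝ) (x : EuclideanSpace ℝ (Fin d)) : EuclideanSpace ℝ (Fin d) :=
  (1 + c - c * ‖x‖ ^ 2) • x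

/-- Its derivative. -/
def dPsi (c : ℝ) (x : EuclideanSpace ℝ (Fin d)) :
    EuclideanSpace ℝ (Fin d) →L[ℝ] EuclideanSpace ℝ (Fin d) :=
  (1 + c - c * ‖x‖ ^ 2) • ContinuousLinearMap.id ℝ _ -
    (2 * c) • (innerSL ℝ x).smulRight x

lemma dPsi_apply (c : ℝ) (x h : 𝔼) :
    dPsi c x h = (1 + c - c * ‖x‖ ^ 2) • h - (2 * c * inner ℝ x h) • x := by
  simp [dPsi, smul_smul]

lemma hasFDerivAt_q (c : ℝ) (x : 𝔼) : HasFDerivAt (fun x : 𝔼 => 1 + c - c * ‖x‖ ^ 2)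
    (-((2 * c) • innerSL ℝ x)) x := by
  have h := ((hasStrictFDerivAt_norm_sq x).hasFDerivAt.const_mul c).const_sub (1 + c)
  refine h.congr_fderiv ?_
  ext k; simp; ring

lemma hasFDerivAt_Psi (c : ℝ) (x : 𝔼) : HasFDerivAt (Psi c) (dPsi c x) x := by
  have h := (hasFDerivAt_q c x).smul (hasFDerivAt_id x)
  refine h.congr_fderiv ?_
  ext1 k
  rw [dPsi_apply]
  simp [sub_eq_add_neg]

lemma contDiff_Psi (c : ℝ) : ContDiff ℝ 1 (Psi (d := d) c) := by
  unfold Psi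
  exact (contDiff_const.sub (contDiff_const.mul (contDiff_norm_sq ℝ))).smul contDiff_id

lemma continuous_dPsi (c : ℝ) : Continuous (dPsi (d := d) c) := by
  have : dPsi (d := d) c = fun x => fderiv ℝ (Psi c) x := by
    funext x; exact (hasFDerivAt_Psi c x).fderiv.symm
  rw [this]
  exact (contDiff_Psi c).continuous_fderiv one_ne_zero

lemma norm_Psi {c : ℝ} {x : 𝔼} (hx : 0 ≤ 1 + c - c * ‖x‖ ^ 2) :
    ‖Psi c x‖ = (1 + c - c * ‖x‖ ^ 2) * ‖x‖ := by
  rw [Psi, norm_smul, Real.norm_of_nonneg hx]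

/-- annulus -/
def ann (d : ℕ) : Set (EuclideanSpace ℝ (Fin d)) := {x | 1 < ‖x‖ ∧ ‖x‖ ≤ 11 / 10}

lemma ann_meas : MeasurableSet (ann d) := by
  have h1 : MeasurableSet {x : 𝔼 | 1 < ‖x‖} := (isOpen_lt continuous_const continuous_norm).measurableSet
  have h2 : MeasurableSet {x : 𝔼 | ‖x‖ ≤ 11 / 10} := (isClosed_le continuous_norm continuous_const).measurableSet
  exact h1.inter h2

lemma q_bound {c t : ℝ} (hc : 1 ≤ c) (hc2 : c ≤ 2) (h1 : 1 ≤ t) (h2 : t ≤ 11 / 10) :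
    1 / 2 < 1 + c - c * t ^ 2 ∧ 1 + c - c * t ^ 2 ≤ 1 := by
  have h3 : t ^ 2 ≤ 121 / 100 := by nlinarith
  have h4 : 1 ≤ t ^ 2 := by nlinarith
  constructor <;> nlinarith

lemma Psi_maps {c : ℝ} (hc : 1 ≤ c) (hc2 : c ≤ 2) {x : 𝔼} (hx : x ∈ ann d) :
    Psi c x ∈ Metric.ball (0 : 𝔼) 1 := by
  obtain ⟨h1, h2⟩ := hx
  obtain ⟨h3, h4⟩ := q_bound hc hc2 h1.le h2
  rw [mem_ball_zero_iff, norm_Psi (by linarith)]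
  have h5 : 1 < c * ‖x‖ * (‖x‖ + 1) := by nlinarith [mul_le_mul hc h1.le zero_le_one (by linarith)]
  nlinarith [mul_pos (sub_pos.2 h1) (sub_pos.2 h5)]

lemma Psi_inj {c : ℝ} (hc : 1 ≤ c) (hc2 : c ≤ 2) : InjOn (Psi c) (ann d) := by
  intro x hx y hy hxy
  obtain ⟨h1, h2⟩ := hx
  obtain ⟨h3, h4⟩ := hy
  obtain ⟨h5, h6⟩ := q_bound hc hc2 h1.le h2
  obtain ⟨h7, h8⟩ := q_bound hc hc2 h3.le h4
  have hn : ‖Psi c x‖ = ‖Psi c y‖ := by rw [hxy]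
  rw [norm_Psi (by linarith), norm_Psi (by linarith)] at hn
  have hst : ‖x‖ = ‖y‖ := by
    have h9 : (‖x‖ - ‖y‖) * ((1 + c) - c * (‖x‖ ^ 2 + ‖x‖ * ‖y‖ + ‖y‖ ^ 2)) = 0 := by
      linear_combination hn
    rcases mul_eq_zero.1 h9 with h | h
    · linarith
    · exfalso
      have : 3 < ‖x‖ ^ 2 + ‖x‖ * ‖y‖ + ‖y‖ ^ 2 := by nlinarith
      nlinarith
  unfold Psi at hxy
  rw [hst] at hxy
  exact smul_right_injective _ (by linarith : (1 + c - c * ‖y‖ ^ 2) ≠ 0) hxy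

lemma dPsi_det_ne {c : ℝ} (hc : 1 ≤ c) (hc2 : c ≤ 2) {x : 𝔼} (h1 : 1 ≤ ‖x‖) (h2 : ‖x‖ ≤ 11 / 10) :
    (dPsi c x).det ≠ 0 := by
  intro h0
  have hk := LinearMap.bot_lt_ker_of_det_eq_zero (f := (dPsi c x : 𝔼 →ₗ[ℝ] 𝔼)) h0
  obtain ⟨k, hk1, hk2⟩ := Submodule.exists_mem_ne_zero_of_ne_bot hk.ne'
  obtain ⟨h3, h4⟩ := q_bound hc hc2 h1 h2
  have hk3 : dPsi c x k = 0 := hk1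
  have h5 : inner ℝ x (dPsi c x k) = 0 := by rw [hk3, inner_zero_right]
  rw [dPsi_apply] at h5 hk3
  rw [inner_sub_right, inner_smul_right, inner_smul_right, real_inner_self_eq_norm_sq] at h5
  have h6 : inner ℝ x k * (1 + c - c * ‖x‖ ^ 2 - 2 * c * ‖x‖ ^ 2) = 0 := by linear_combination h5
  have h7 : inner ℝ x k = 0 := by
    rcases mul_eq_zero.1 h6 with h | h
    · exact h
    · exfalso
      have : 1 ≤ ‖x‖ ^ 2 := by nlinarith
      nlinarith
  rw [h7] at hk3
  simp only [mul_zero, zero_smul, sub_zero] at hk3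
  rcases smul_eq_zero.1 hk3 with h | h
  · linarith
  · exact hk2 h

lemma change_var {c : ℝ} (hc : 1 ≤ c) (hc2 : c ≤ 2) : ∃ κ : ℝ, 0 ≤ κ ∧ ∀ f : 𝔼 → ℝ, Continuous f →
    (∀ x, 0 ≤ f x) → ∫ x in ann d, f (Psi c x) ≤ κ * ∫ x in Metric.ball (0 : 𝔼) 1, f x := by
  have hcomp : IsCompact {x : 𝔼 | 1 ≤ ‖x‖ ∧ ‖x‖ ≤ 11 / 10} := by
    refine (isCompact_closedBall (0 : 𝔼) (11 / 10)).of_isClosed_subset ?_ ?_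
    · exact (isClosed_le continuous_const continuous_norm).inter
        (isClosed_le continuous_norm continuous_const)
    · intro x hx; rw [mem_closedBall_zero_iff]; exact hx.2
  have hdetc : Continuous fun x : 𝔼 => (dPsi c x).det :=
    ContinuousLinearMap.continuous_det.comp (continuous_dPsi c)
  have hcont : ContinuousOn (fun x : 𝔼 => |(dPsi c x).det|⁻¹) {x : 𝔼 | 1 ≤ ‖x‖ ∧ ‖x‖ ≤ 11 / 10} :=
    hdetc.abs.continuousOn.inv₀ fun x hx => abs_ne_zero.2 (dPsi_det_ne hc hc2 hx.1 hx.2)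
  obtain ⟨κ, hκ⟩ := hcomp.bddAbove_image hcont
  refine ⟨max κ 0, le_max_right _ _, fun f hf hf0 => ?_⟩
  have hle : ∀ x ∈ ann d, 1 ≤ max κ 0 * |(dPsi c x).det| := by
    intro x hx
    have h1 : |(dPsi c x).det|⁻¹ ≤ κ := hκ ⟨x, ⟨hx.1.le, hx.2⟩, rfl⟩
    have h2 : 0 < |(dPsi c x).det| := abs_pos.2 (dPsi_det_ne hc hc2 hx.1.le hx.2)
    have h3 := h1.trans (le_max_left κ 0)
    rwa [inv_le_iff_one_le_mul₀ h2] at h3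
  have hint : ∀ g : 𝔼 → ℝ, Continuous g → IntegrableOn g (ann d) := fun g hg =>
    (hg.continuousOn.integrableOn_compact (isCompact_closedBall (0 : 𝔼) (11 / 10))).mono_set
      fun x hx => by rw [mem_closedBall_zero_iff]; exact hx.2
  have hfP : Continuous fun x => f (Psi c x) := hf.comp (contDiff_Psi c).continuous
  calc ∫ x in ann d, f (Psi c x)
      ≤ ∫ x in ann d, max κ 0 * (|(dPsi c x).det| • f (Psi c x)) := by
        refine setIntegral_mono_on (hint _ hfP)
          (hint _ (continuous_const.mul (hdetc.abs.smul hfP))) ann_meas fun x hx => ?_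
        have := mul_le_mul_of_nonneg_right (hle x hx) (hf0 (Psi c x))
        rw [smul_eq_mul]; linarith
    _ = max κ 0 * ∫ x in Psi c '' ann d, f x := by
        rw [integral_const_mul, integral_image_eq_integral_abs_det_fderiv_smul volume ann_meas
          (fun x _ => (hasFDerivAt_Psi c x).hasFDerivWithinAt) (Psi_inj hc hc2)]
    _ ≤ _ := by
        refine mul_le_mul_of_nonneg_left ?_ (le_max_right _ _)
        refine setIntegral_mono_set ?_ (Eventually.of_forall hf0) (HasSubset.Subset.eventuallyLE ?_)
        · exact (hf.continuousOn.integrableOn_compact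
            (isCompact_closedBall (0 : 𝔼) 1)).mono_set Metric.ball_subset_closedBall
        · rintro _ ⟨x, hx, rfl⟩
          exact Psi_maps hc hc2 hx

end extension
end

noncomputable section
set_option linter.unusedSectionVars false
section extension2
open scoped Topology
variable {d : ℕ}
local notation "𝔼" => EuclideanSpace ℝ (Fin d)
local notation "𝕎" => EuclideanSpace ℝ (Fin d × Fin d)

lemma dPsi_symm (c : ℝ) (x y h : 𝔼) : inner ℝ (dPsi c x y) h = inner ℝ y (dPsi c x h) := by
  rw [dPsi_apply, dPsi_apply, inner_sub_left, inner_sub_right, inner_smul_left, inner_smul_right,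
    inner_smul_left, inner_smul_right, real_inner_comm x y]
  simp only [conj_trivial]
  ring

lemma dPsi_norm {c : ℝ} (hc : 1 ≤ c) (hc2 : c ≤ 2) {x : 𝔼} (h1 : 1 ≤ ‖x‖) (h2 : ‖x‖ ≤ 11 / 10)
    (h : 𝔼) : ‖dPsi c x h‖ ≤ 6 * ‖h‖ := by
  obtain ⟨h3, h4⟩ := q_bound hc hc2 h1 h2
  rw [dPsi_apply]
  refine (norm_sub_le _ _).trans ?_
  rw [norm_smul, norm_smul, Real.norm_of_nonneg (by linarith : 0 ≤ 1 + c - c * ‖x‖ ^ 2), norm_mul,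
    Real.norm_of_nonneg (by linarith : 0 ≤ 2 * c)]
  have h5 : ‖inner ℝ x h‖ ≤ ‖x‖ * ‖h‖ := norm_inner_le_norm x h
  have h6 : ‖x‖ ^ 2 ≤ 121 / 100 := by nlinarith
  have h7 : 2 * c * ‖inner ℝ x h‖ * ‖x‖ ≤ 4 * (‖x‖ * ‖h‖) * ‖x‖ := by
    gcongr; linarith
  have h8 : (1 + c - c * ‖x‖ ^ 2) * ‖h‖ ≤ 1 * ‖h‖ := by gcongr
  nlinarith [mul_le_mul_of_nonneg_right h6 (norm_nonneg h)]

/-- pulled-back field -/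
def Pfield (c : ℝ) (u : EuclideanSpace ℝ (Fin d) → EuclideanSpace ℝ (Fin d))
    (x : EuclideanSpace ℝ (Fin d)) : EuclideanSpace ℝ (Fin d) := dPsi c x (u (Psi c x))

lemma contDiff_dPsi (c : ℝ) : ContDiff ℝ 1 (dPsi (d := d) c) := by
  have h : ContDiff ℝ 2 (Psi (d := d) c) := by
    unfold Psi
    exact (contDiff_const.sub (contDiff_const.mul (contDiff_norm_sq ℝ))).smul contDiff_id
  have : dPsi (d := d) c = fun x => fderiv ℝ (Psi c) x := by
    funext x; exact (hasFDerivAt_Psi c x).fderiv.symm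
  rw [this]
  exact h.fderiv_right (by norm_num)

lemma contDiff_Pfield (c : ℝ) {u : 𝔼 → 𝔼} (hu : ContDiff ℝ 1 u) : ContDiff ℝ 1 (Pfield c u) :=
  (contDiff_dPsi c).clm_apply (hu.comp (contDiff_Psi c))

lemma Pfield_quad {c : ℝ} (hc : 1 ≤ c) (hc2 : c ≤ 2) {u : 𝔼 → 𝔼} (hu : ContDiff ℝ 1 u) {x : 𝔼}
    (h1 : 1 ≤ ‖x‖) (h2 : ‖x‖ ≤ 11 / 10) (h : 𝔼) :
    |inner ℝ (fderiv ℝ (Pfield c u) x h) h| ≤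
      (36 * d ^ 2 * ‖symW 1 (opW (fderiv ℝ u (Psi c x)))‖ + 14 * ‖u (Psi c x)‖) * ‖h‖ ^ 2 := by
  have hP : HasFDerivAt (Pfield c u) (fderiv ℝ (Pfield c u) x) x :=
    ((contDiff_Pfield c hu).differentiable one_ne_zero x).hasFDerivAt
  have hU : HasFDerivAt (fun y => u (Psi c y)) ((fderiv ℝ u (Psi c x)).comp (dPsi c x)) x :=
    ((hu.differentiable one_ne_zero (Psi c x)).hasFDerivAt).comp x (hasFDerivAt_Psi c x)
  have hV1 : HasFDerivAt (fun y : 𝔼 => (1 + c - c * ‖y‖ ^ 2) • h)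
      ((-((2 * c) • innerSL ℝ x)).smulRight h) x := (hasFDerivAt_q c x).smul_const h
  have hin : HasFDerivAt (fun y : 𝔼 => 2 * c * inner ℝ y h) ((2 * c) • innerSL ℝ h) x := by
    have h0 := ((innerSL ℝ h).hasFDerivAt (x := x)).const_mul (2 * c)
    refine (h0.congr_of_eventuallyEq (Eventually.of_forall fun y => ?_))
    simp [real_inner_comm h y]
  have hV : HasFDerivAt (fun y => dPsi c y h) ((-((2 * c) • (innerSL ℝ) x)).smulRight h -
      ((2 * c * inner ℝ x h) • ContinuousLinearMap.id ℝ 𝔼 +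
        ((2 * c) • (innerSL ℝ) h).smulRight (id x))) x := by
    refine (hV1.sub (hin.smul (hasFDerivAt_id x))).congr_of_eventuallyEq
      (Eventually.of_forall fun y => ?_)
    exact dPsi_apply c y h
  have hg := hU.inner ℝ hV
  have hg2 := hP.inner ℝ (hasFDerivAt_const h x)
  have hfun : (fun y => inner ℝ (Pfield c u y) h) =
      fun y => inner ℝ (u (Psi c y)) (dPsi c y h) := by
    funext y
    rw [Pfield, dPsi_symm]
  rw [hfun] at hg2
  have hun := congrArg (fun L : 𝔼 →L[ℝ] ℝ => L h) (HasFDerivAt.unique hg2 hg)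
  simp only [ContinuousLinearMap.comp_apply, fderivInnerCLM_apply, ContinuousLinearMap.prod_apply,
    _root_.zero_apply, inner_zero_right, zero_add, _root_.sub_apply,
    _root_.add_apply, ContinuousLinearMap.smulRight_apply,
    _root_.smul_apply, _root_.neg_apply, ContinuousLinearMap.id_apply,
    id, innerSL_apply_apply, smul_eq_mul, real_inner_self_eq_norm_sq] at hun
  rw [hun]
  set A := fderiv ℝ u (Psi c x)
  set k := dPsi c x h with hk
  have hkn : ‖k‖ ≤ 6 * ‖h‖ := dPsi_norm hc hc2 h1 h2 h
  have e1 : |inner ℝ (A k) k| ≤ 36 * d ^ 2 * ‖symW 1 (opW A)‖ * ‖h‖ ^ 2 := by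
    refine (quad_le_symW A k).trans ?_
    have : ‖k‖ ^ 2 ≤ 36 * ‖h‖ ^ 2 := by nlinarith [norm_nonneg k, norm_nonneg h]
    calc (d:ℝ) ^ 2 * ‖symW 1 (opW A)‖ * ‖k‖ ^ 2 ≤ d ^ 2 * ‖symW 1 (opW A)‖ * (36 * ‖h‖ ^ 2) := by
          gcongr
      _ = _ := by ring
  set B : 𝔼 := -(2 * c * inner ℝ x h) • h - ((2 * c * inner ℝ x h) • h + (2 * c * ‖h‖ ^ 2) • x)
    with hB
  have hBn : ‖B‖ ≤ 14 * ‖h‖ ^ 2 := by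
    have h5 : |inner ℝ x h| ≤ ‖x‖ * ‖h‖ := abs_real_inner_le_norm x h
    have h6 : |2 * c * inner ℝ x h| ≤ 4 * (‖x‖ * ‖h‖) := by
      rw [abs_mul, abs_of_nonneg (by linarith : 0 ≤ 2 * c)]
      gcongr; linarith
    have h7 : ‖B‖ ≤ |2 * c * inner ℝ x h| * ‖h‖ + (|2 * c * inner ℝ x h| * ‖h‖
        + (2 * c * ‖h‖ ^ 2) * ‖x‖) := by
      refine (norm_sub_le _ _).trans (add_le_add ?_ ((norm_add_le _ _).trans (add_le_add ?_ ?_)))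
      · rw [norm_smul, norm_neg, norm_eq_abs]
      · rw [norm_smul, norm_eq_abs]
      · rw [norm_smul, Real.norm_of_nonneg (by positivity)]
    have h8 : |2 * c * inner ℝ x h| * ‖h‖ ≤ 4 * (‖x‖ * ‖h‖) * ‖h‖ := by gcongr
    have h9 : (2 * c * ‖h‖ ^ 2) * ‖x‖ ≤ (2 * 2 * ‖h‖ ^ 2) * ‖x‖ := by gcongr
    have h10 : ‖x‖ * ‖h‖ ^ 2 ≤ 11 / 10 * ‖h‖ ^ 2 := by gcongr
    nlinarith [sq_nonneg ‖h‖]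
  have e2 : |inner ℝ (u (Psi c x)) B| ≤ 14 * ‖u (Psi c x)‖ * ‖h‖ ^ 2 := by
    refine (abs_real_inner_le_norm _ _).trans ?_
    nlinarith [mul_le_mul_of_nonneg_left hBn (norm_nonneg (u (Psi c x)))]
  refine (abs_add_le _ _).trans ?_
  rw [add_mul, add_comm]
  exact add_le_add e1 e2

lemma Pfield_norm {c : ℝ} (hc : 1 ≤ c) (hc2 : c ≤ 2) (u : 𝔼 → 𝔼) {x : 𝔼}
    (h1 : 1 ≤ ‖x‖) (h2 : ‖x‖ ≤ 11 / 10) : ‖Pfield c u x‖ ≤ 6 * ‖u (Psi c x)‖ :=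
  dPsi_norm hc hc2 h1 h2 _

/-- cut-off -/
def chiB (d : ℕ) : ContDiffBump (0 : EuclideanSpace ℝ (Fin d)) :=
  { rIn := 1, rOut := 11 / 10, rIn_pos := one_pos, rIn_lt_rOut := by norm_num }

/-- extension outside of the ball -/
def Wext (u : EuclideanSpace ℝ (Fin d) → EuclideanSpace ℝ (Fin d))
    (x : EuclideanSpace ℝ (Fin d)) : EuclideanSpace ℝ (Fin d) :=
  chiB d x • ((2:ℝ) • Pfield 1 u x - Pfield 2 u x)

lemma Wext_contDiff {u : 𝔼 → 𝔼} (hu : ContDiff ℝ 1 u) : ContDiff ℝ 1 (Wext u) :=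
  ((chiB d).contDiff (n := 1)).smul
    (((contDiff_Pfield 1 hu).const_smul (2:ℝ)).sub (contDiff_Pfield 2 hu))

lemma Wext_supp (u : 𝔼 → 𝔼) : HasCompactSupport (Wext u) :=
  (chiB d).hasCompactSupport.smul_right

lemma Wext_sphere (u : 𝔼 → 𝔼) {x : 𝔼} (hx : ‖x‖ = 1) : Wext u x = u x := by
  have h1 : chiB d x = 1 := (chiB d).one_of_mem_closedBall (by
    rw [mem_closedBall_zero_iff, hx]; exact le_rfl)
  have h2 : ∀ c, Psi c x = x := fun c => by rw [Psi, hx]; simp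
  rw [Wext, h1, Pfield, Pfield, h2, h2, dPsi_apply, dPsi_apply, hx, one_smul]
  module

lemma Wext_fderiv_zero (u : 𝔼 → 𝔼) {x : 𝔼} (hx : 11 / 10 < ‖x‖) : fderiv ℝ (Wext u) x = 0 := by
  have : x ∉ tsupport (Wext u) := fun h => by
    have h1 := closure_mono (Function.support_smul_subset_left (chiB d) _) h
    have h2 : x ∈ tsupport (chiB d) := h1
    rw [(chiB d).tsupport_eq, mem_closedBall_zero_iff] at h2
    have : (chiB d).rOut = 11 / 10 := rfl
    linarith
  by_contra h4
  exact this (support_fderiv_subset ℝ h4)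

lemma Wext_sym : ∃ L : ℝ, 0 ≤ L ∧ ∀ u : 𝔼 → 𝔼, ContDiff ℝ 1 u → ∀ x : 𝔼, 1 ≤ ‖x‖ →
    ‖x‖ ≤ 11 / 10 → ‖symW 1 (opW (fderiv ℝ (Wext u) x))‖ ≤
      L * ((‖symW 1 (opW (fderiv ℝ u (Psi 1 x)))‖ + ‖u (Psi 1 x)‖) +
        (‖symW 1 (opW (fderiv ℝ u (Psi 2 x)))‖ + ‖u (Psi 2 x)‖)) := by
  obtain ⟨M, hM⟩ := ContDiff.lipschitzWith_of_hasCompactSupport (chiB d).hasCompactSupport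
    ((chiB d).contDiff (n := 1)) one_ne_zero
  refine ⟨3 * d * (72 * d ^ 2 + 28 + 12 * M), by positivity, fun u hu x h1 h2 => ?_⟩
  set S1 := ‖symW 1 (opW (fderiv ℝ u (Psi 1 x)))‖
  set S2 := ‖symW 1 (opW (fderiv ℝ u (Psi 2 x)))‖
  set U1 := ‖u (Psi 1 x)‖
  set U2 := ‖u (Psi 2 x)‖
  have hS1 : 0 ≤ S1 := norm_nonneg _
  have hS2 : 0 ≤ S2 := norm_nonneg _
  have hU1 : 0 ≤ U1 := norm_nonneg _
  have hU2 : 0 ≤ U2 := norm_nonneg _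
  rw [mul_assoc]
  have hκ : 0 ≤ (72 * (d:ℝ) ^ 2 + 28 + 12 * M) * (S1 + U1 + (S2 + U2)) := by positivity
  refine symW_le_of_quad _ hκ fun h => ?_
  have hP1 := ((contDiff_Pfield 1 hu).differentiable one_ne_zero x).hasFDerivAt
  have hP2 := ((contDiff_Pfield 2 hu).differentiable one_ne_zero x).hasFDerivAt
  have hch := (((chiB d).contDiff (n := 1)).differentiable one_ne_zero x).hasFDerivAt
  have hW : HasFDerivAt (Wext u) _ x := hch.smul ((hP1.const_smul (2:ℝ)).sub hP2)
  rw [hW.fderiv]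
  have q1 := Pfield_quad (c := 1) le_rfl (by norm_num) hu h1 h2 h
  have q2 := Pfield_quad (c := 2) (by norm_num) le_rfl hu h1 h2 h
  have n1 := Pfield_norm (c := 1) le_rfl (by norm_num) u h1 h2
  have n2 := Pfield_norm (c := 2) (by norm_num) le_rfl u h1 h2
  have hc0 : 0 ≤ chiB d x := (chiB d).nonneg
  have hc1 : chiB d x ≤ 1 := (chiB d).le_one
  set D1 := inner ℝ (fderiv ℝ (Pfield 1 u) x h) h with hD1
  set D2 := inner ℝ (fderiv ℝ (Pfield 2 u) x h) h with hD2
  have hDc : |fderiv ℝ (chiB d) x h| ≤ M * ‖h‖ := by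
    refine ((fderiv ℝ (chiB d) x).le_opNorm h).trans ?_
    gcongr
    exact norm_fderiv_le_of_lipschitz ℝ hM
  set Dc := fderiv ℝ (chiB d) x h with hDc'
  set Z := (2:ℝ) • Pfield 1 u x - Pfield 2 u x with hZ
  have hZn : |inner ℝ Z h| ≤ (12 * U1 + 6 * U2) * ‖h‖ := by
    refine (abs_real_inner_le_norm _ _).trans ?_
    gcongr
    refine (norm_sub_le _ _).trans ?_
    rw [norm_smul, Real.norm_of_nonneg (by norm_num : (0:ℝ) ≤ 2)]
    linarith
  have hE : ∀ T : 𝔼 →L[ℝ] 𝔼, T h = chiB d x • ((2:ℝ) • fderiv ℝ (Pfield 1 u) x h -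
      fderiv ℝ (Pfield 2 u) x h) + Dc • Z →
      |inner ℝ (T h) h| ≤ (72 * d ^ 2 + 28 + 12 * M) * (S1 + U1 + (S2 + U2)) * ‖h‖ ^ 2 := by
    intro T hT
    have e1 : inner ℝ (T h) h = chiB d x * (2 * D1 - D2) + Dc * inner ℝ Z h := by
      rw [hT, inner_add_left, inner_smul_left, inner_smul_left, inner_sub_left, inner_smul_left]
      simp [hD1, hD2]
    rw [e1]
    have e2 : |chiB d x * (2 * D1 - D2)| ≤ 2 * |D1| + |D2| := by
      rw [abs_mul, abs_of_nonneg hc0]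
      have : |2 * D1 - D2| ≤ 2 * |D1| + |D2| := by
        refine (abs_sub _ _).trans ?_
        rw [abs_mul, abs_of_pos (by norm_num : (0:ℝ) < 2)]
      calc _ ≤ 1 * |2 * D1 - D2| := by gcongr
        _ ≤ _ := by linarith
    have e3 : |Dc * inner ℝ Z h| ≤ (M * ‖h‖) * ((12 * U1 + 6 * U2) * ‖h‖) := by
      rw [abs_mul]; gcongr
    refine (abs_add_le _ _).trans ((add_le_add e2 e3).trans ?_)
    have hd0 : (0:ℝ) ≤ (d:ℝ) ^ 2 := by positivity
    have hM0 : (0:ℝ) ≤ M := M.2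
    have hh : 0 ≤ ‖h‖ ^ 2 := by positivity
    have key : 2 * (36 * d ^ 2 * S1 + 14 * U1) + (36 * d ^ 2 * S2 + 14 * U2)
        + M * (12 * U1 + 6 * U2) ≤ (72 * d ^ 2 + 28 + 12 * M) * (S1 + U1 + (S2 + U2)) := by
      nlinarith [mul_nonneg hd0 hS1, mul_nonneg hd0 hS2, mul_nonneg hd0 hU1, mul_nonneg hd0 hU2,
        mul_nonneg hM0 hS1, mul_nonneg hM0 hS2, mul_nonneg hM0 hU1, mul_nonneg hM0 hU2]
    have := mul_le_mul_of_nonneg_right key hh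
    linarith
  apply hE
  simp [hZ, hDc']

end extension2
end

noncomputable section
set_option linter.unusedSectionVars false
section kornball
open scoped Topology
variable {d : ℕ}
local notation "𝔼" => EuclideanSpace ℝ (Fin d)
local notation "𝕎" => EuclideanSpace ℝ (Fin d × Fin d)
variable {φ φ' φ'' : ℝ → ℝ} {G : ℝ}

/-- glued field -/
def Vext (u : EuclideanSpace ℝ (Fin d) → EuclideanSpace ℝ (Fin d))
    (x : EuclideanSpace ℝ (Fin d)) : EuclideanSpace ℝ (Fin d) :=
  if ‖x‖ ≤ 1 then u x else Wext u x

lemma Vext_in (u : 𝔼 → 𝔼) {x : 𝔼} (h : ‖x‖ ≤ 1) : Vext u x = u x := if_pos h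
lemma Vext_out (u : 𝔼 → 𝔼) {x : 𝔼} (h : 1 < ‖x‖) : Vext u x = Wext u x := if_neg (not_le.2 h)

lemma Vext_fderiv_in (u : 𝔼 → 𝔼) {x : 𝔼} (h : ‖x‖ < 1) : fderiv ℝ (Vext u) x = fderiv ℝ u x := by
  refine Filter.EventuallyEq.fderiv_eq ?_
  have : {y : 𝔼 | ‖y‖ < 1} ∈ 𝓝 x := (isOpen_lt continuous_norm continuous_const).mem_nhds h
  filter_upwards [this] with y hy using Vext_in u (le_of_lt hy)

lemma Vext_fderiv_out (u : 𝔼 → 𝔼) {x : 𝔼} (h : 1 < ‖x‖) :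
    fderiv ℝ (Vext u) x = fderiv ℝ (Wext u) x := by
  refine Filter.EventuallyEq.fderiv_eq ?_
  have : {y : 𝔼 | 1 < ‖y‖} ∈ 𝓝 x := (isOpen_lt continuous_const continuous_norm).mem_nhds h
  filter_upwards [this] with y hy using Vext_out u hy

lemma Vext_supp (u : 𝔼 → 𝔼) : HasCompactSupport (Vext u) := by
  obtain ⟨R, hR⟩ := (Wext_supp u).isCompact.isBounded.subset_closedBall (0 : 𝔼)
  refine HasCompactSupport.intro (isCompact_closedBall (0 : 𝔼) (max R 1)) fun x hx => ?_
  rw [mem_closedBall_zero_iff, not_le, max_lt_iff] at hx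
  rw [Vext_out u hx.2]
  refine image_eq_zero_of_notMem_tsupport fun h => ?_
  have := hR h
  rw [mem_closedBall_zero_iff] at this
  linarith [hx.1]

lemma Vext_lip {u : 𝔼 → 𝔼} (hu : ContDiff ℝ 1 u) : ∃ K : NNReal, LipschitzWith K (Vext u) := by
  obtain ⟨K1, h1⟩ := hu.contDiffOn.exists_lipschitzOnWith one_ne_zero (convex_closedBall (0 : 𝔼) 1)
    (isCompact_closedBall _ _)
  obtain ⟨K2, h2⟩ := ContDiff.lipschitzWith_of_hasCompactSupport (Wext_supp u)
    (Wext_contDiff hu) one_ne_zero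
  have cross : ∀ x y : 𝔼, ‖x‖ ≤ 1 → 1 < ‖y‖ →
      dist (Vext u x) (Vext u y) ≤ (2 * K1 + K2) * dist x y := by
    intro x y hx hy
    set z : 𝔼 := ‖y‖⁻¹ • y with hz
    have hy0 : 0 < ‖y‖ := by linarith
    have hzn : ‖z‖ = 1 := by
      rw [hz, norm_smul, norm_inv, norm_norm, inv_mul_cancel₀ hy0.ne']
    have hzy : dist z y ≤ dist x y := by
      have : y - z = (1 - ‖y‖⁻¹) • y := by rw [hz, sub_smul, one_smul]
      have h3 : ‖y‖⁻¹ ≤ 1 := inv_le_one_of_one_le₀ hy.le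
      rw [dist_comm, dist_eq_norm, this, norm_smul, Real.norm_of_nonneg (by linarith), sub_mul,
        inv_mul_cancel₀ hy0.ne', dist_comm, dist_eq_norm]
      have := norm_sub_norm_le y x
      linarith
    have hxz : dist x z ≤ 2 * dist x y := by
      have := dist_triangle x y z
      rw [dist_comm y z] at this
      linarith
    have e1 := h1.dist_le_mul x (by rw [mem_closedBall_zero_iff]; exact hx) z
      (by rw [mem_closedBall_zero_iff]; exact hzn.le)
    have e2 := h2.dist_le_mul z y
    rw [Vext_in u hx, Vext_out u hy]
    rw [Wext_sphere u hzn] at e2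
    have e3 : (K1:ℝ) * dist x z ≤ K1 * (2 * dist x y) := by gcongr
    have e4 : (K2:ℝ) * dist z y ≤ K2 * dist x y := by gcongr
    have := dist_triangle (u x) (u z) (Wext u y)
    linarith
  refine ⟨2 * K1 + K2, LipschitzWith.of_dist_le_mul fun x y => ?_⟩
  push_cast
  have hd0 : 0 ≤ dist x y := dist_nonneg
  have m1 : 0 ≤ (K1:ℝ) * dist x y := by positivity
  have m2 : 0 ≤ (K2:ℝ) * dist x y := by positivity
  rcases le_or_gt ‖x‖ 1 with hx | hx <;> rcases le_or_gt ‖y‖ 1 with hy | hy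
  · rw [Vext_in u hx, Vext_in u hy]
    have := h1.dist_le_mul x (by rw [mem_closedBall_zero_iff]; exact hx) y
      (by rw [mem_closedBall_zero_iff]; exact hy)
    linarith
  · exact cross x y hx hy
  · rw [dist_comm, dist_comm x y]; exact cross y x hy hx
  · rw [Vext_out u hx, Vext_out u hy]
    have := h2.dist_le_mul x y
    linarith

lemma phi_sum4 (hN : IsNFunction φ φ') (hG : GoodPhi φ φ' φ'' G) {L s a b c e : ℝ} (hL : 0 ≤ L)
    (hs0 : 0 ≤ s) (ha : 0 ≤ a) (hb : 0 ≤ b) (hc : 0 ≤ c) (he : 0 ≤ e)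
    (hs : s ≤ L * ((a + b) + (c + e))) :
    φ s ≤ (4 * L + 1) ^ (1 + G) * ((φ a + φ b) + (φ c + φ e)) := by
  set m := max (max a b) (max c e) with hm
  have h1 : a ≤ m := (le_max_left _ _).trans (le_max_left _ _)
  have h2 : b ≤ m := (le_max_right _ _).trans (le_max_left _ _)
  have h3 : c ≤ m := (le_max_left _ _).trans (le_max_right _ _)
  have h4 : e ≤ m := (le_max_right _ _).trans (le_max_right _ _)
  have hm0 : 0 ≤ m := ha.trans h1
  have h5 : s ≤ (4 * L + 1) * m := by nlinarith
  have h6 : φ s ≤ φ ((4 * L + 1) * m) :=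
    phi_mono hN hG (mem_Ici.2 hs0) (mem_Ici.2 (by positivity)) h5
  have pa := phi_nonneg hN hG ha
  have pb := phi_nonneg hN hG hb
  have pc := phi_nonneg hN hG hc
  have pe := phi_nonneg hN hG he
  have h7 : φ m ≤ (φ a + φ b) + (φ c + φ e) := by
    rcases max_choice (max a b) (max c e) with h | h
    · rcases max_choice a b with h' | h' <;> rw [hm, h, h'] <;> linarith
    · rcases max_choice c e with h' | h' <;> rw [hm, h, h'] <;> linarith
  refine h6.trans ((phi_scale hN hG (by linarith) hm0).trans ?_)
  gcongr

theorem korn_ball (hd : 1 ≤ d) (G : ℝ) (hG1 : 1 ≤ G) : ∃ C : ℝ, 0 ≤ C ∧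
    ∀ φ φ' φ'' : ℝ → ℝ, IsNFunction φ φ' → GoodPhi φ φ' φ'' G →
    ∀ u : 𝔼 → 𝔼, ContDiff ℝ 1 u →
      ∫ x in Metric.ball (0 : 𝔼) 1, φ ‖opW (fderiv ℝ u x)‖ ≤
      C * ∫ x in Metric.ball (0 : 𝔼) 1, (φ ‖symW 1 (opW (fderiv ℝ u x))‖ + φ ‖u x‖) := by
  obtain ⟨C, hC, hK⟩ := korn_lip (d := d) hd G hG1
  obtain ⟨L, hL, hW⟩ := Wext_sym (d := d)
  obtain ⟨κ1, hκ1, hv1⟩ := change_var (d := d) (c := 1) le_rfl (by norm_num)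
  obtain ⟨κ2, hκ2, hv2⟩ := change_var (d := d) (c := 2) (by norm_num) le_rfl
  set Q : ℝ := (4 * L + 1) ^ (1 + G) with hQ
  have hQ0 : 0 ≤ Q := by positivity
  refine ⟨C * (1 + Q * (κ1 + κ2)), by positivity, fun φ φ' φ'' hN hG u hu => ?_⟩
  obtain ⟨K, hlip⟩ := Vext_lip hu
  have hcp := phi_abs_cont hN hG
  have hmain := hK φ φ' φ'' hN hG (Vext u) K hlip (Vext_supp u)
  have hcT : ∀ T : (𝔼 →L[ℝ] 𝔼) →L[ℝ] 𝕎, Continuous (fun A : 𝔼 →L[ℝ] 𝔼 => φ ‖T A‖) := fun T =>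
    (hcp.comp (T.continuous.norm)).congr fun A => by simp
  have hint : ∀ T : (𝔼 →L[ℝ] 𝔼) →L[ℝ] 𝕎, Integrable fun x => φ ‖T (fderiv ℝ (Vext u) x)‖ := by
    intro T
    obtain ⟨R, hR⟩ := (Vext_supp u).isCompact.isBounded.subset_closedBall (0 : 𝔼)
    have hI : Integrable (indicator (Metric.closedBall (0 : 𝔼) R) fun _ => φ (‖T‖ * K)) := by
      rw [integrable_indicator_iff Metric.isClosed_closedBall.measurableSet]
      exact integrableOn_const (isCompact_closedBall _ _).measure_lt_top.ne
    refine hI.mono' ((hcT T).measurable.comp (measurable_fderiv ℝ (Vext u))).aestronglyMeasurable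
      (Eventually.of_forall fun x => ?_)
    by_cases hx : x ∈ Metric.closedBall (0 : 𝔼) R
    · rw [indicator_of_mem hx, Real.norm_of_nonneg (phi_nonneg hN hG (norm_nonneg _))]
      refine phi_mono hN hG (mem_Ici.2 (norm_nonneg _)) (mem_Ici.2 (by positivity)) ?_
      refine (T.le_opNorm _).trans ?_
      gcongr
      exact norm_fderiv_le_of_lipschitz ℝ hlip
    · have h3 : fderiv ℝ (Vext u) x = 0 := by
        by_contra h4
        exact hx (hR (support_fderiv_subset ℝ h4))
      rw [indicator_of_notMem hx, h3]
      simp [phi_zero hN]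
  set B := Metric.ball (0 : 𝔼) 1 with hB
  have hBm : MeasurableSet B := Metric.isOpen_ball.measurableSet
  have hfc : Continuous (fderiv ℝ u) := hu.continuous_fderiv one_ne_zero
  -- densities
  set f : 𝔼 → ℝ := fun x => φ ‖symW 1 (opW (fderiv ℝ u x))‖ + φ ‖u x‖ with hf
  have hs_cont : Continuous fun x => φ ‖symW 1 (opW (fderiv ℝ u x))‖ :=
    (hcT ((symW 1).comp opW)).comp hfc
  have hu_cont : Continuous fun x => φ ‖u x‖ :=
    (hcp.comp hu.continuous.norm).congr fun x => by simp
  have hf_cont : Continuous f := hs_cont.add hu_cont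
  have hf0 : ∀ x, 0 ≤ f x := fun x =>
    add_nonneg (phi_nonneg hN hG (norm_nonneg _)) (phi_nonneg hN hG (norm_nonneg _))
  have hiB : ∀ g : 𝔼 → ℝ, Continuous g → IntegrableOn g B := fun g hg =>
    (hg.continuousOn.integrableOn_compact (isCompact_closedBall (0 : 𝔼) 1)).mono_set
      Metric.ball_subset_closedBall
  have hiA : ∀ g : 𝔼 → ℝ, Continuous g → IntegrableOn g (ann d) := fun g hg =>
    (hg.continuousOn.integrableOn_compact (isCompact_closedBall (0 : 𝔼) (11 / 10))).mono_set
      fun x hx => by rw [mem_closedBall_zero_iff]; exact hx.2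
  have s1 : ∫ x in B, φ ‖opW (fderiv ℝ u x)‖ ≤ ∫ x, φ ‖opW (fderiv ℝ (Vext u) x)‖ := by
    have : ∫ x in B, φ ‖opW (fderiv ℝ u x)‖ = ∫ x in B, φ ‖opW (fderiv ℝ (Vext u) x)‖ := by
      refine setIntegral_congr_fun hBm fun x hx => ?_
      rw [hB, mem_ball_zero_iff] at hx
      simp only [Vext_fderiv_in u hx]
    rw [this]
    exact setIntegral_le_integral (hint opW)
      (Eventually.of_forall fun x => phi_nonneg hN hG (norm_nonneg _))
  have s2 : ∫ x, φ ‖symW 1 (opW (fderiv ℝ (Vext u) x))‖ =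
      (∫ x in B, φ ‖symW 1 (opW (fderiv ℝ u x))‖) +
        ∫ x in ann d, φ ‖symW 1 (opW (fderiv ℝ (Wext u) x))‖ := by
    have hi2 : Integrable fun x => φ ‖symW 1 (opW (fderiv ℝ (Vext u) x))‖ :=
      hint ((symW 1).comp opW)
    rw [← integral_add_compl hBm hi2]
    congr 1
    · refine setIntegral_congr_fun hBm fun x hx => ?_
      rw [hB, mem_ball_zero_iff] at hx
      simp only [Vext_fderiv_in u hx]
    · have hann : ∫ x in ann d, φ ‖symW 1 (opW (fderiv ℝ (Wext u) x))‖ =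
          ∫ x in ann d, φ ‖symW 1 (opW (fderiv ℝ (Vext u) x))‖ := by
        refine setIntegral_congr_fun ann_meas fun x hx => ?_
        simp only [Vext_fderiv_out u hx.1]
      rw [hann, ← integral_indicator hBm.compl, ← integral_indicator ann_meas]
      refine integral_congr_ae ?_
      have hsph : ∀ᵐ x ∂(volume : Measure 𝔼), x ∉ Metric.sphere (0 : 𝔼) 1 :=
        measure_eq_zero_iff_ae_notMem.1 (Measure.addHaar_sphere_of_ne_zero _ _ one_ne_zero)
      filter_upwards [hsph] with x hx
      rw [mem_sphere_zero_iff_norm] at hx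
      rcases lt_or_gt_of_ne hx with h | h
      · rw [indicator_of_notMem, indicator_of_notMem]
        · exact fun h' => absurd h'.1 (by linarith)
        · simp [hB, h]
      · rw [indicator_of_mem (by simp [hB, h.le])]
        by_cases h2 : ‖x‖ ≤ 11 / 10
        · rw [indicator_of_mem (show x ∈ ann d from ⟨h, h2⟩)]
        · rw [indicator_of_notMem (fun h' => h2 h'.2), Vext_fderiv_out u h,
            Wext_fderiv_zero u (not_le.1 h2)]
          simp [phi_zero hN]
  have s3 : ∫ x in ann d, φ ‖symW 1 (opW (fderiv ℝ (Wext u) x))‖ ≤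
      Q * (κ1 * (∫ x in B, f x) + κ2 * ∫ x in B, f x) := by
    have c1 : Continuous fun x => f (Psi 1 x) := hf_cont.comp (contDiff_Psi 1).continuous
    have c2 : Continuous fun x => f (Psi 2 x) := hf_cont.comp (contDiff_Psi 2).continuous
    calc _ ≤ ∫ x in ann d, Q * (f (Psi 1 x) + f (Psi 2 x)) := by
          refine setIntegral_mono_on (hiA _ ?_) (hiA _ (continuous_const.mul (c1.add c2))) ann_meas
            fun x hx => ?_
          · exact (hcT ((symW 1).comp opW)).comp ((Wext_contDiff hu).continuous_fderiv one_ne_zero)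
          · exact phi_sum4 hN hG hL (norm_nonneg _) (norm_nonneg _) (norm_nonneg _) (norm_nonneg _)
              (norm_nonneg _) (hW u hu x hx.1.le hx.2)
      _ = Q * ((∫ x in ann d, f (Psi 1 x)) + ∫ x in ann d, f (Psi 2 x)) := by
          rw [integral_const_mul, integral_add (hiA _ c1) (hiA _ c2)]
      _ ≤ _ := by
          have := hv1 f hf_cont hf0
          have := hv2 f hf_cont hf0
          gcongr
  have s4 : ∫ x in B, φ ‖symW 1 (opW (fderiv ℝ u x))‖ ≤ ∫ x in B, f x := by
    refine setIntegral_mono_on (hiB _ hs_cont) (hiB _ hf_cont) hBm fun x _ => ?_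
    have := phi_nonneg hN hG (norm_nonneg (u x))
    simp only [hf]; linarith
  calc _ ≤ _ := s1
    _ ≤ _ := hmain
    _ ≤ C * ((∫ x in B, f x) + Q * (κ1 * (∫ x in B, f x) + κ2 * ∫ x in B, f x)) := by
        rw [s2]
        gcongr
    _ = _ := by ring

end kornball
end

noncomputable section
set_option linter.unusedSectionVars false
section kornfinal
open scoped Topology
variable {d : ℕ}
local notation "𝔼" => EuclideanSpace ℝ (Fin d)

lemma scale_int (x₀ : 𝔼) {r : ℝ} (hr : 0 < r) : ∃ D : ℝ, 0 ≤ D ∧ ∀ g : 𝔼 → ℝ,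
    ∫ x in Metric.ball x₀ r, g x = D * ∫ x in Metric.ball (0 : 𝔼) 1, g (x₀ + r • x) := by
  refine ⟨|(r • ContinuousLinearMap.id ℝ 𝔼).det|, abs_nonneg _, fun g => ?_⟩
  have him : (fun x : 𝔼 => x₀ + r • x) '' Metric.ball (0 : 𝔼) 1 = Metric.ball x₀ r := by
    ext y
    constructor
    · rintro ⟨x, hx, rfl⟩
      rw [mem_ball_zero_iff] at hx
      rw [mem_ball_iff_norm, add_sub_cancel_left, norm_smul, Real.norm_of_nonneg hr.le]
      nlinarith
    · intro hy
      rw [mem_ball_iff_norm] at hy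
      refine ⟨r⁻¹ • (y - x₀), ?_, ?_⟩
      · rw [mem_ball_zero_iff, norm_smul, norm_inv, Real.norm_of_nonneg hr.le,
          inv_mul_lt_iff₀ hr]
        linarith
      · simp [smul_smul, hr.ne']
  rw [← him, integral_image_eq_integral_abs_det_fderiv_smul volume
    Metric.isOpen_ball.measurableSet (f' := fun _ => r • ContinuousLinearMap.id ℝ 𝔼)]
  · simp only [smul_eq_mul]
    rw [integral_const_mul]
  · intro x _
    exact (((hasFDerivAt_id x).const_smul r).const_add x₀).hasFDerivWithinAt
  · intro x _ y _ h
    have h' : r • x = r • y := add_left_cancel h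
    exact smul_right_injective _ hr.ne' h'

theorem korn_all (d : ℕ) (hd : 1 ≤ d) (G : ℝ) (hG1 : 1 ≤ G) : ∃ C : ℝ,
    ∀ φ φ' φ'' : ℝ → ℝ, IsNFunction φ φ' → GoodPhi φ φ' φ'' G →
    ∀ (x₀ : EuclideanSpace ℝ (Fin d)) (r : ℝ), 0 < r →
    ∀ u : EuclideanSpace ℝ (Fin d) → EuclideanSpace ℝ (Fin d), ContDiff ℝ 1 u →
    ∀ m : EuclideanSpace ℝ (Fin d),
      (∫ x in Metric.ball x₀ r, φ (fnorm (jac u x))) ≤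
        C * ∫ x in Metric.ball x₀ r,
          (φ (fnorm ((1 / 2 : ℝ) • (jac u x + (jac u x).transpose))) + φ (‖u x - m‖ / r)) := by
  obtain ⟨C, hC, h⟩ := korn_ball (d := d) hd G hG1
  refine ⟨C, fun φ φ' φ'' hN hG x₀ r hr u hu m => ?_⟩
  obtain ⟨D, hD, hs⟩ := scale_int x₀ hr
  rw [hs, hs]
  set v : EuclideanSpace ℝ (Fin d) → EuclideanSpace ℝ (Fin d) :=
    fun x => r⁻¹ • (u (x₀ + r • x) - m) with hv
  have hvc : ContDiff ℝ 1 v :=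
    ((hu.comp (contDiff_const.add (contDiff_id.const_smul r))).sub contDiff_const).const_smul r⁻¹
  have hfd : ∀ x, fderiv ℝ v x = fderiv ℝ u (x₀ + r • x) := by
    intro x
    have h1 : HasFDerivAt (fun x : EuclideanSpace ℝ (Fin d) => x₀ + r • x)
        (r • ContinuousLinearMap.id ℝ (EuclideanSpace ℝ (Fin d))) x :=
      ((hasFDerivAt_id x).const_smul r).const_add x₀
    have h2 : HasFDerivAt v _ x :=
      ((((hu.differentiable one_ne_zero (x₀ + r • x)).hasFDerivAt).comp x h1).sub_const
        m).const_smul r⁻¹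
    rw [h2.fderiv]
    ext k i
    simp [smul_smul, hr.ne']
  have hj : ∀ x, jac v x = jac u (x₀ + r • x) := fun x => by unfold jac; rw [hfd]
  have hn : ∀ x, ‖v x‖ = ‖u (x₀ + r • x) - m‖ / r := fun x => by
    rw [hv]
    simp only
    rw [norm_smul, norm_inv, Real.norm_of_nonneg hr.le, div_eq_inv_mul]
  have := h φ φ' φ'' hN hG v hvc
  simp only [norm_opW, norm_symW, hj, hn] at this
  have h3 := mul_le_mul_of_nonneg_left this hD
  linarith
end kornfinal

end

/-- Orlicz–Korn inequality (Lemma 7):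
`∫_{B_r} φ(|∇u|) ≤ C ∫_{B_r} (φ(|Du|) + φ(|u − ⟨u⟩_{B_r}|/r))`
with `C` depending only on `G` and `d`. -/
theorem orlicz_korn :
    ∃ C : ℝ → ℕ → ℝ, ∀ (G : ℝ) (d : ℕ) (φ φ' φ'' : ℝ → ℝ),
      IsNFunction φ φ' → GoodPhi φ φ' φ'' G → 1 ≤ d →
      ∀ (x₀ : EuclideanSpace ℝ (Fin d)) (r : ℝ), 0 < r →
      ∀ u : EuclideanSpace ℝ (Fin d) → EuclideanSpace ℝ (Fin d), ContDiff ℝ 1 u →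
      (∫ x in Metric.ball x₀ r, φ (fnorm (jac u x))) ≤
        C G d * ∫ x in Metric.ball x₀ r,
          (φ (fnorm ((1 / 2 : ℝ) • (jac u x + (jac u x).transpose))) +
            φ (‖u x - ⨍ y in Metric.ball x₀ r, u y‖ / r)) := by
  classical
  refine ⟨fun G d => if h : 1 ≤ d ∧ 1 ≤ G then (korn_all d h.1 G h.2).choose else 0, ?_⟩
  intro G d φ φ' φ'' hN hG hd x₀ r hr u hu
  have h : 1 ≤ d ∧ 1 ≤ G := ⟨hd, hG.1⟩
  beta_reduce
  rw [dif_pos h]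
  exact (korn_all d h.1 G h.2).choose_spec φ φ' φ'' hN hG x₀ r hr u hu _
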